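/- arXiv:2008.10500 — 3 statements merged into one kernel-verified Lean document; each statement's English description precedes it below -/
import Mathlib

section
/- Let α > 1 be an irrational real number and let k ≥ 1 be an integer. Then there exists a constant C_k > 0 such that |E_α^{(k)}(t)| ≤ C_k · t^{1−k} for all sufficiently small t > 0, where E_α^{(k)} denotes the k-th derivative of E_α. -/
open Filter Topology Real Asymptotics

/-- `K(u) = u²/sinh²(u)` for `u ≠ 0`, with `K(0) = 1`. -/
noncomputable def KKer (u : ℝ) : ℝ :=
  if u = 0 then 1 else u ^ 2 / Real.sinh u ^ 2

/-- `E_α(t) = ∑_{ℓ ≥ 1} ∫₀^{{αℓ}} ∫₀^u K((αℓ - v)t/2)/(αℓ - v)² dv du`. -/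
noncomputable def EBeatty (α : ℝ) (t : ℝ) : ℝ :=
  ∑' ℓ : ℕ, ∫ u in (0 : ℝ)..Int.fract (α * (ℓ + 1)),
    ∫ v in (0 : ℝ)..u, KKer ((α * (ℓ + 1) - v) * t / 2) / (α * (ℓ + 1) - v) ^ 2

noncomputable def psi (w : ℂ) : ℂ := (dslope Complex.exp 0 w)⁻¹

lemma psi_eq {w : ℂ} (hw : w ≠ 0) : psi w = w / (Complex.exp w - 1) := by
  rw [psi, dslope_of_ne _ hw, slope_def_field]
  simp

lemma exp_sub_ge (w : ℂ) : Real.exp w.re - 1 ≤ ‖Complex.exp w - 1‖ := by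
  have := norm_sub_norm_le (Complex.exp w) 1
  rwa [Complex.norm_exp, norm_one] at this

lemma exp_sub_ne {w : ℂ} (hw : 0 < w.re) : Complex.exp w - 1 ≠ 0 := by
  have h1 := exp_sub_ge w
  have h2 : 1 < Real.exp w.re := Real.one_lt_exp_iff.2 hw
  intro h
  rw [h, norm_zero] at h1
  linarith

lemma dslope_ne {w : ℂ} (hw : |w.im| ≤ w.re) : dslope Complex.exp 0 w ≠ 0 := by
  by_cases h0 : w = 0
  · subst h0
    simp [dslope_same]
  · have hre : 0 < w.re := by
      rcases (lt_or_eq_of_le ((abs_nonneg _).trans hw)) with h | h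
      · exact h
      · exfalso; apply h0
        rw [← h] at hw
        exact Complex.ext h.symm (abs_nonpos_iff.1 hw)
    rw [dslope_of_ne _ h0, slope_def_field]
    have := exp_sub_ne hre
    simp [this, h0]

lemma psi_an {w : ℂ} (hw : |w.im| ≤ w.re) : AnalyticAt ℂ psi w := by
  have hd : Differentiable ℂ (dslope Complex.exp 0) := by
    rw [← differentiableOn_univ]
    exact (Complex.differentiableOn_dslope (by simp)).2 Complex.differentiable_exp.differentiableOn
  exact (hd.analyticAt w).inv (dslope_ne hw)

lemma psi_bound : ∃ C > (0 : ℝ), ∀ w : ℂ, |w.im| ≤ w.re →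
    ‖deriv (deriv psi) w‖ ≤ C * Real.exp (-(w.re / 2)) := by
  -- compact part
  have hK : IsCompact {w : ℂ | |w.im| ≤ w.re ∧ w.re ≤ 1} := by
    apply Metric.isCompact_of_isClosed_isBounded
    · exact (isClosed_le (Complex.continuous_im.abs) Complex.continuous_re).inter
        (isClosed_le Complex.continuous_re continuous_const)
    · refine (Metric.isBounded_closedBall (x := (0:ℂ)) (r := 2)).subset ?_
      rintro w ⟨h1, h2⟩
      rw [mem_closedBall_zero_iff]
      have := Complex.norm_le_abs_re_add_abs_im w
      have h3 : |w.re| = w.re := abs_of_nonneg ((abs_nonneg _).trans h1)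
      linarith
  have hc : ContinuousOn (fun w => deriv (deriv psi) w) {w : ℂ | |w.im| ≤ w.re ∧ w.re ≤ 1} :=
    fun w hw => (psi_an hw.1).deriv.deriv.continuousAt.continuousWithinAt
  obtain ⟨C1, hC1⟩ := hK.exists_bound_of_continuousOn hc
  refine ⟨|C1| * Real.exp 1 + 1000, by positivity, fun w hw => ?_⟩
  by_cases h1 : w.re ≤ 1
  · calc ‖deriv (deriv psi) w‖ ≤ C1 := hC1 w ⟨hw, h1⟩
      _ ≤ |C1| * (Real.exp 1 * Real.exp (-(w.re/2))) := by
          have : 1 ≤ Real.exp 1 * Real.exp (-(w.re/2)) := by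
            rw [← Real.exp_add]; exact Real.one_le_exp (by linarith)
          nlinarith [le_abs_self C1, abs_nonneg C1]
      _ ≤ _ := by
          have := Real.exp_pos (-(w.re/2))
          nlinarith
  · push Not at h1
    have hball : ∀ v ∈ Metric.closedBall w (1/2), 1/2 ≤ v.re ∧ w.re - 1/2 ≤ v.re ∧ ‖v‖ ≤ 2 * w.re + 1/2 := by
      intro v hv
      rw [Metric.mem_closedBall, dist_eq_norm] at hv
      have h2 := (Complex.abs_re_le_norm (v - w)).trans hv
      rw [Complex.sub_re, abs_le] at h2
      have h3 : ‖v‖ ≤ ‖v - w‖ + ‖w‖ := by simpa using norm_add_le (v - w) w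
      have h4 := Complex.norm_le_abs_re_add_abs_im w
      have h5 : |w.re| = w.re := abs_of_nonneg ((abs_nonneg _).trans hw)
      refine ⟨by linarith, by linarith, by linarith⟩
    have hne : ∀ v : ℂ, 1/2 ≤ v.re → v ≠ 0 := by
      rintro v hv rfl
      norm_num at hv
    have hdiff : DiffContOnCl ℂ (fun v => v / (Complex.exp v - 1)) (Metric.ball w (1/2)) := by
      apply DifferentiableOn.diffContOnCl
      intro v hv
      have hv' := hball v (Metric.closure_ball_subset_closedBall hv)
      have := exp_sub_ne (w := v) (by linarith [hv'.1])
      apply DifferentiableAt.differentiableWithinAt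
      fun_prop (disch := assumption)
    have hS : ∀ v ∈ Metric.sphere w (1/2), ‖v / (Complex.exp v - 1)‖ ≤ 100 * Real.exp (-(w.re/2)) := by
      intro v hv
      have hv' := hball v (Metric.sphere_subset_closedBall hv)
      have h6 := exp_sub_ge v
      have h7 : Real.exp (w.re - 1/2) ≤ Real.exp v.re := Real.exp_le_exp.2 hv'.2.1
      have h8 : 1 + 1/2 ≤ Real.exp (w.re - 1/2) := by
        have := Real.add_one_le_exp (w.re - 1/2); linarith
      have h9 : Real.exp (w.re - 1/2) / 3 ≤ ‖Complex.exp v - 1‖ := by linarith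
      rw [norm_div, div_le_iff₀ (by linarith)]
      have e1 : Real.exp (w.re - 1/2) = Real.exp (w.re/2) * Real.exp (w.re/2 - 1/2) := by
        rw [← Real.exp_add]; ring_nf
      have e2 : Real.exp (-(w.re/2)) * Real.exp (w.re/2) = 1 := by
        rw [← Real.exp_add]; simp
      have e3 : w.re / 2 + 1/2 ≤ Real.exp (w.re/2 - 1/2) := by
        have := Real.add_one_le_exp (w.re/2 - 1/2); linarith
      calc ‖v‖ ≤ 2 * w.re + 1/2 := hv'.2.2
        _ ≤ 100/3 * Real.exp (w.re/2 - 1/2) := by linarith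
        _ = 100 * Real.exp (-(w.re/2)) * (Real.exp (w.re - 1/2) / 3) := by
            rw [e1]; linear_combination (-(100/3) * Real.exp (w.re/2 - 1/2)) * e2
        _ ≤ _ := by gcongr
    have hcau := Complex.norm_iteratedDeriv_le_of_forall_mem_sphere_norm_le 2 (by norm_num) hdiff hS
    have heq : psi =ᶠ[𝓝 w] (fun v => v / (Complex.exp v - 1)) := by
      filter_upwards [Metric.closedBall_mem_nhds w (by norm_num : (0:ℝ) < 1/2)] with v hv
      exact psi_eq (hne v (hball v hv).1)
    rw [(heq.deriv.deriv).eq_of_nhds]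
    rw [iteratedDeriv_succ, iteratedDeriv_one] at hcau
    refine hcau.trans ?_
    have := Real.exp_pos (-(w.re/2))
    have h0 : 0 ≤ |C1| * Real.exp 1 := by positivity
    norm_num [Nat.factorial]
    nlinarith

lemma taylor_bound {C : ℝ} (hC : ∀ w : ℂ, |w.im| ≤ w.re →
    ‖deriv (deriv psi) w‖ ≤ C * Real.exp (-(w.re / 2))) (hC0 : 0 < C)
    (z : ℂ) (hz : |z.im| ≤ z.re) (n f : ℝ) (hn : 0 ≤ n) (hf : 0 ≤ f) (hf1 : f ≤ 1) :
    ‖psi ((n + f : ℝ) * z) - psi (n * z) - f * z * deriv psi ((n + f : ℝ) * z)‖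
      ≤ ‖z‖ ^ 2 * C * Real.exp (-(n * z.re / 2)) := by
  have hzr : 0 ≤ z.re := (abs_nonneg _).trans hz
  set M := C * Real.exp (-(n * z.re / 2)) with hM
  have hM0 : 0 ≤ M := by positivity
  set b : ℂ := (n + f : ℝ) * z with hb
  set a : ℂ := n * z with ha
  have hseg : ∀ x ∈ segment ℝ a b, |x.im| ≤ x.re ∧ n * z.re ≤ x.re ∧ ‖x - b‖ ≤ ‖z‖ := by
    intro x hx
    rw [segment_eq_image] at hx
    obtain ⟨θ, ⟨h0, h1⟩, rfl⟩ := hx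
    have hx : (1 - θ) • a + θ • b = ((n + θ * f : ℝ) : ℂ) * z := by
      simp only [ha, hb, Complex.real_smul]; push_cast; ring
    have hnf : 0 ≤ θ * f := by positivity
    simp only [hx]
    refine ⟨?_, ?_, ?_⟩
    · rw [Complex.im_ofReal_mul, Complex.re_ofReal_mul, abs_mul, abs_of_nonneg (by positivity)]
      gcongr
    · rw [Complex.re_ofReal_mul]; nlinarith
    · have : ((n + θ * f : ℝ) : ℂ) * z - b = ((- ((1 - θ) * f) : ℝ) : ℂ) * z := by
        rw [hb]; push_cast; ring
      rw [this, norm_mul, Complex.norm_real, norm_neg, Real.norm_eq_abs, abs_of_nonneg (mul_nonneg (by linarith) hf)]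
      have : (1 - θ) * f ≤ 1 := by nlinarith
      nlinarith [norm_nonneg z]
  have hbs : b ∈ segment ℝ a b := right_mem_segment ℝ a b
  have has : a ∈ segment ℝ a b := left_mem_segment ℝ a b
  have h1 : ∀ x ∈ segment ℝ a b, ‖deriv psi x - deriv psi b‖ ≤ M * ‖z‖ := by
    intro x hx
    have := (convex_segment a b).norm_image_sub_le_of_norm_deriv_le (𝕜 := ℂ) (f := deriv psi) (C := M)
      (fun y hy => (psi_an (hseg y hy).1).deriv.differentiableAt)
      (fun y hy => (hC y (hseg y hy).1).trans (by
        rw [hM]; gcongr; exact (hseg y hy).2.1)) hbs hx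
    exact this.trans (by gcongr; exact (hseg x hx).2.2)
  have h2 := (convex_segment a b).norm_image_sub_le_of_norm_hasDerivWithin_le (𝕜 := ℂ)
    (f := fun x => psi x - deriv psi b * x) (f' := fun x => deriv psi x - deriv psi b * 1)
    (C := M * ‖z‖)
    (fun y hy => (((psi_an (hseg y hy).1).differentiableAt.hasDerivAt).sub
      ((hasDerivAt_id y).const_mul _)).hasDerivWithinAt)
    (fun y hy => by rw [mul_one]; exact h1 y hy) hbs has
  rw [norm_sub_rev] at h2
  have h3 : (psi b - deriv psi b * b - (psi a - deriv psi b * a)) = psi b - psi a - f * z * deriv psi b := by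
    rw [show b = a + f * z by rw [ha, hb]; push_cast; ring]; ring
  simp only [h3] at h2
  refine h2.trans ?_
  calc M * ‖z‖ * ‖a - b‖ ≤ M * ‖z‖ * ‖z‖ := by gcongr; exact (hseg a has).2.2
    _ = _ := by rw [hM]; ring

/-- term of the derivative -/
noncomputable def gTerm (n f : ℝ) (z : ℂ) : ℂ :=
  (psi ((n + f : ℝ) * z) - psi (n * z) - f * z * deriv psi ((n + f : ℝ) * z)) / z

lemma gTerm_diff (n f : ℝ) (hn : 0 ≤ n) (hf : 0 ≤ f) (z : ℂ) (hz : |z.im| < z.re) :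
    DifferentiableAt ℂ (gTerm n f) z := by
  have hz0 : z ≠ 0 := by rintro rfl; simp at hz
  have hs : ∀ m : ℝ, 0 ≤ m → |((m : ℂ) * z).im| ≤ ((m : ℂ) * z).re := by
    intro m hm
    rw [Complex.im_ofReal_mul, Complex.re_ofReal_mul, abs_mul, abs_of_nonneg hm]
    gcongr
  have h1 : ∀ m : ℝ, 0 ≤ m → DifferentiableAt ℂ (fun z : ℂ => psi (m * z)) z := fun m hm =>
    DifferentiableAt.comp (f := fun z : ℂ => m * z) z (psi_an (hs m hm)).differentiableAt (by fun_prop)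
  have h2 : ∀ m : ℝ, 0 ≤ m → DifferentiableAt ℂ (fun z : ℂ => deriv psi (m * z)) z := fun m hm =>
    DifferentiableAt.comp (f := fun z : ℂ => m * z) z (psi_an (hs m hm)).deriv.differentiableAt (by fun_prop)
  unfold gTerm
  have a1 := h1 (n+f) (by positivity)
  have a2 := h1 n hn
  have a3 := h2 (n+f) (by positivity)
  exact ((a1.sub a2).sub ((by fun_prop : DifferentiableAt ℂ (fun z : ℂ => (f:ℂ) * z) z).mul a3)).div differentiableAt_id hz0

lemma gTerm_bound {C : ℝ} (hC : ∀ w : ℂ, |w.im| ≤ w.re →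
    ‖deriv (deriv psi) w‖ ≤ C * Real.exp (-(w.re / 2))) (hC0 : 0 < C)
    (z : ℂ) (hz : |z.im| < z.re) (m n f : ℝ) (hm : 0 ≤ m) (hn : m ≤ n) (hf : 0 ≤ f) (hf1 : f ≤ 1) :
    ‖gTerm n f z‖ ≤ 2 * C * (z.re * Real.exp (-(m * z.re / 2))) := by
  have hz0 : z ≠ 0 := by rintro rfl; simp at hz
  have hzr : 0 < z.re := (abs_nonneg _).trans_lt hz
  have h := taylor_bound hC hC0 z hz.le n f (hm.trans hn) hf hf1
  have hzn : 0 < ‖z‖ := norm_pos_iff.2 hz0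
  rw [gTerm, norm_div, div_le_iff₀ hzn]
  refine h.trans ?_
  have h4 := Complex.norm_le_abs_re_add_abs_im z
  rw [abs_of_pos hzr] at h4
  calc ‖z‖ ^ 2 * C * Real.exp (-(n * z.re / 2)) ≤ ‖z‖ ^ 2 * C * Real.exp (-(m * z.re / 2)) := by gcongr
    _ = ‖z‖ * (‖z‖ * (C * Real.exp (-(m * z.re / 2)))) := by ring
    _ ≤ ‖z‖ * (2 * z.re * (C * Real.exp (-(m * z.re / 2)))) := by
        gcongr; linarith
    _ = _ := by ring

lemma exp_sum (x : ℝ) (hx : 0 < x) :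
    HasSum (fun l : ℕ => Real.exp (-(((l:ℝ)+1) * x / 2))) (Real.exp (-(x/2)) * (1 - Real.exp (-(x/2)))⁻¹) := by
  have := (hasSum_geometric_of_lt_one (r := Real.exp (-(x/2))) (Real.exp_pos _).le
    (Real.exp_lt_one_iff.2 (by linarith))).mul_left (Real.exp (-(x/2)))
  convert! this using 2 with l
  rw [← Real.exp_nat_mul, ← Real.exp_add]
  congr 1
  ring

lemma exp_sum_le (x : ℝ) (hx : 0 < x) :
    x * (Real.exp (-(x/2)) * (1 - Real.exp (-(x/2)))⁻¹) ≤ 2 := by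
  have h1 : Real.exp (-(x/2)) < 1 := Real.exp_lt_one_iff.2 (by linarith)
  have h2 := Real.add_one_le_exp (x/2)
  have h3 : Real.exp (-(x/2)) * Real.exp (x/2) = 1 := by rw [← Real.exp_add]; simp
  rw [← mul_assoc, ← div_eq_mul_inv, div_le_iff₀ (by linarith)]
  nlinarith [Real.exp_pos (-(x/2))]

noncomputable def Bf (s : ℝ) : ℝ := (Real.exp s - 1)⁻¹
noncomputable def Bd (s : ℝ) : ℝ := - Real.exp s / (Real.exp s - 1) ^ 2
noncomputable def phif (s : ℝ) : ℝ := Real.log (1 - Real.exp (-s))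

lemma exp_sub_pos {s : ℝ} (hs : 0 < s) : 0 < Real.exp s - 1 := by
  have := Real.one_lt_exp_iff.2 hs
  linarith

lemma Bf_deriv {s : ℝ} (hs : 0 < s) : HasDerivAt Bf (Bd s) s :=
  ((Real.hasDerivAt_exp s).sub_const 1).inv (exp_sub_pos hs).ne'

lemma phif_deriv {s : ℝ} (hs : 0 < s) : HasDerivAt phif (Bf s) s := by
  have h1 : HasDerivAt (fun s : ℝ => 1 - Real.exp (-s)) (- (Real.exp (-s) * (-1))) s :=
    ((hasDerivAt_neg s).exp).const_sub 1
  have h2 : 0 < 1 - Real.exp (-s) := by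
    have := Real.exp_lt_one_iff.2 (by linarith : -s < 0); linarith
  have h3 := h1.log h2.ne'
  have h4 := exp_sub_pos hs
  have h5 := Real.exp_pos s
  convert! h3 using 1
  rw [Real.exp_neg] at h2 ⊢
  rw [Bf]
  field_simp

lemma ker_eq {x t : ℝ} (hx : 0 < x) (ht : 0 < t) :
    KKer (x * t / 2) / x ^ 2 = - (t * (Bd (x * t) * t)) := by
  have hxt : 0 < x * t := by positivity
  rw [KKer, if_neg (by positivity), Bd, Real.sinh_eq, Real.exp_neg]
  have h4 := exp_sub_pos hxt
  have h1 : Real.exp (x * t) = Real.exp (x * t / 2) ^ 2 := by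
    rw [← Real.exp_nat_mul]; congr 1; push_cast; ring
  have h6 := Real.exp_pos (x * t / 2)
  rw [h1] at h4 ⊢
  have h7 : (Real.exp (x * t / 2) - (Real.exp (x * t / 2))⁻¹) = (Real.exp (x * t / 2) ^ 2 - 1) / Real.exp (x * t / 2) := by
    field_simp
  rw [h7]
  field_simp
  try ring

lemma inner_eq {a u t : ℝ} (hu : 0 ≤ u) (hua : u < a) (ht : 0 < t) :
    ∫ v in (0:ℝ)..u, KKer ((a - v) * t / 2) / (a - v) ^ 2 = t * Bf ((a - u) * t) - t * Bf (a * t) := by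
  have hpos : ∀ v ∈ Set.uIcc 0 u, 0 < a - v := by
    intro v hv; rw [Set.uIcc_of_le hu] at hv; linarith [hv.2]
  have hd : ∀ v ∈ Set.uIcc 0 u, HasDerivAt (fun v => t * Bf ((a - v) * t)) (- (t * (Bd ((a - v) * t) * t))) v := by
    intro v hv
    have h1 : HasDerivAt (fun v : ℝ => (a - v) * t) (-1 * t) v :=
      ((hasDerivAt_id v).const_sub a).mul_const t
    have h0 := Bf_deriv (mul_pos (hpos v hv) ht)
    have h2 := (HasDerivAt.comp (h := fun v : ℝ => (a - v) * t) v h0 h1).const_mul t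
    convert! h2 using 1
    ring
  rw [intervalIntegral.integral_congr (g := fun v => - (t * (Bd ((a - v) * t) * t)))
    (fun v hv => ker_eq (hpos v hv) ht)]
  rw [intervalIntegral.integral_eq_sub_of_hasDerivAt hd]
  · simp
  · apply ContinuousOn.intervalIntegrable
    intro v hv
    have := (exp_sub_pos (mul_pos (hpos v hv) ht)).ne'
    apply ContinuousAt.continuousWithinAt
    unfold Bd
    have h3 : (Real.exp ((a - v) * t) - 1) ^ 2 ≠ 0 := pow_ne_zero 2 this
    fun_prop (disch := assumption)

lemma outer_eq {a f t : ℝ} (hf : 0 ≤ f) (hfa : f < a) (ht : 0 < t) :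
    ∫ u in (0:ℝ)..f, ∫ v in (0:ℝ)..u, KKer ((a - v) * t / 2) / (a - v) ^ 2
      = phif (a * t) - phif ((a - f) * t) - f * (t * Bf (a * t)) := by
  have hpos : ∀ v ∈ Set.uIcc 0 f, 0 < a - v := by
    intro v hv; rw [Set.uIcc_of_le hf] at hv; linarith [hv.2]
  have hd : ∀ v ∈ Set.uIcc 0 f, HasDerivAt (fun v => - phif ((a - v) * t) - v * (t * Bf (a * t)))
      (t * Bf ((a - v) * t) - t * Bf (a * t)) v := by
    intro v hv
    have h1 : HasDerivAt (fun v : ℝ => (a - v) * t) (-1 * t) v :=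
      ((hasDerivAt_id v).const_sub a).mul_const t
    have h0 := phif_deriv (mul_pos (hpos v hv) ht)
    have h2 := (HasDerivAt.comp (h := fun v : ℝ => (a - v) * t) v h0 h1).neg.sub
      ((hasDerivAt_id v).mul_const (t * Bf (a * t)))
    convert! h2 using 1
    ring
  rw [intervalIntegral.integral_congr (g := fun u => t * Bf ((a - u) * t) - t * Bf (a * t))
    (fun v hv => inner_eq (by rw [Set.uIcc_of_le hf] at hv; exact hv.1) (by linarith [hpos v hv]) ht)]
  rw [intervalIntegral.integral_eq_sub_of_hasDerivAt hd]
  · simp; ring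
  · apply ContinuousOn.intervalIntegrable
    intro v hv
    have := (exp_sub_pos (mul_pos (hpos v hv) ht)).ne'
    apply ContinuousAt.continuousWithinAt
    unfold Bf
    fun_prop (disch := assumption)

lemma psi_real {s : ℝ} (hs : 0 < s) : psi (s : ℂ) = ((s * Bf s : ℝ) : ℂ) := by
  rw [psi_eq (by exact_mod_cast hs.ne'), Bf]
  push_cast
  rw [div_eq_mul_inv]

lemma psi_deriv_real {s : ℝ} (hs : 0 < s) : deriv psi (s : ℂ) = ((Bf s + s * Bd s : ℝ) : ℂ) := by
  have hne : Complex.exp (s:ℂ) - 1 ≠ 0 := exp_sub_ne (by simpa using hs)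
  have heq : psi =ᶠ[𝓝 (s:ℂ)] (fun v => v * (Complex.exp v - 1)⁻¹) := by
    filter_upwards [isOpen_ne.mem_nhds (by exact_mod_cast hs.ne' : (s:ℂ) ≠ 0)] with v hv
    rw [psi_eq hv, div_eq_mul_inv]
  rw [heq.deriv_eq]
  have h := (hasDerivAt_id (s:ℂ)).mul (((Complex.hasDerivAt_exp (s:ℂ)).sub_const 1).inv hne)
  refine h.deriv.trans ?_
  rw [Bf, Bd]
  push_cast
  simp

lemma term_deriv {n f t : ℝ} (hn : 0 < n) (hf : 0 ≤ f) (ht : 0 < t) :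
    HasDerivAt (fun t => phif ((n + f) * t) - phif (n * t) - f * (t * Bf ((n + f) * t)))
      (gTerm n f t).re t := by
  have e : ∀ m : ℝ, HasDerivAt (fun t : ℝ => m * t) (m * 1) t := fun m => (hasDerivAt_id t).const_mul m
  have hnf : 0 < n + f := by linarith
  have h1 := HasDerivAt.comp t (phif_deriv (mul_pos hnf ht)) (e (n + f))
  have h2 := HasDerivAt.comp t (phif_deriv (mul_pos hn ht)) (e n)
  have h3 := HasDerivAt.comp t (Bf_deriv (mul_pos hnf ht)) (e (n + f))
  have h4 := (h1.sub h2).sub (((hasDerivAt_id t).mul h3).const_mul f)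
  have hg : gTerm n f t = (((((n + f) * t) * Bf ((n + f) * t) - (n * t) * Bf (n * t)
      - f * t * (Bf ((n + f) * t) + ((n + f) * t) * Bd ((n + f) * t))) / t : ℝ) : ℂ) := by
    rw [gTerm, ← Complex.ofReal_mul, ← Complex.ofReal_mul, psi_real (mul_pos hnf ht),
      psi_real (mul_pos hn ht), psi_deriv_real (mul_pos hnf ht)]
    push_cast
    ring
  rw [hg, Complex.ofReal_re]
  convert! h4 using 1
  simp only [id, Function.comp]
  field_simp

lemma KKer_le (u : ℝ) : ‖KKer u‖ ≤ 1 := by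
  rw [KKer]
  split_ifs with h
  · simp
  · rw [Real.norm_eq_abs, abs_of_nonneg (by positivity)]
    apply div_le_one_of_le₀ _ (by positivity)
    rw [sq_le_sq, Real.abs_sinh]
    exact Real.self_le_sinh_iff.2 (abs_nonneg u)

lemma term_bound {a f t m : ℝ} (hf : 0 ≤ f) (hf1 : f ≤ 1) (hm : 0 < m) (hfa : m ≤ a - f) :
    ‖∫ u in (0:ℝ)..f, ∫ v in (0:ℝ)..u, KKer ((a - v) * t / 2) / (a - v) ^ 2‖ ≤ 1 / m ^ 2 := by
  have h1 : ∀ u ∈ Set.uIoc 0 f, ‖∫ v in (0:ℝ)..u, KKer ((a - v) * t / 2) / (a - v) ^ 2‖ ≤ 1 / m ^ 2 := by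
    intro u hu
    rw [Set.uIoc_of_le hf] at hu
    have := intervalIntegral.norm_integral_le_of_norm_le_const (a := 0) (b := u) (C := 1 / m ^ 2)
      (f := fun v => KKer ((a - v) * t / 2) / (a - v) ^ 2) (by
        intro v hv
        rw [Set.uIoc_of_le hu.1.le] at hv
        have : m ≤ a - v := by linarith [hv.2, hu.2]
        rw [norm_div, norm_pow, Real.norm_eq_abs (a - v), abs_of_pos (by linarith)]
        exact div_le_div₀ zero_le_one (KKer_le _) (by positivity) (by gcongr))
    refine this.trans ?_
    rw [sub_zero, abs_of_pos hu.1]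
    exact mul_le_of_le_one_right (by positivity) (hu.2.trans hf1)
  refine (intervalIntegral.norm_integral_le_of_norm_le_const h1).trans ?_
  rw [sub_zero, abs_of_nonneg hf]
  exact mul_le_of_le_one_right (by positivity) hf1

noncomputable def GB (α : ℝ) (z : ℂ) : ℂ :=
  ∑' l : ℕ, gTerm (⌊α * (l + 1)⌋ : ℝ) (Int.fract (α * (l + 1))) z

lemma floor_ge {α : ℝ} (hα : 1 < α) (l : ℕ) : ((l : ℝ) + 1) ≤ (⌊α * (l + 1)⌋ : ℝ) := by
  have : ((l : ℤ) + 1) ≤ ⌊α * (l + 1)⌋ := by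
    rw [Int.le_floor]
    push_cast
    have : (0:ℝ) ≤ l := Nat.cast_nonneg l
    nlinarith
  exact_mod_cast this

lemma l_bound
    {α C : ℝ} (hα : 1 < α) (hC : ∀ w : ℂ, |w.im| ≤ w.re →
    ‖deriv (deriv psi) w‖ ≤ C * Real.exp (-(w.re / 2))) (hC0 : 0 < C)
    (l : ℕ) (z : ℂ) (hz : |z.im| < z.re) :
    ‖gTerm (⌊α * (l + 1)⌋ : ℝ) (Int.fract (α * (l + 1))) z‖
      ≤ 2 * C * (z.re * Real.exp (-(((l:ℝ) + 1) * z.re / 2))) :=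
  gTerm_bound hC hC0 z hz _ _ _ (by positivity) (floor_ge hα l) (Int.fract_nonneg _) (Int.fract_lt_one _).le

lemma l_bound'
    {α C : ℝ} (hα : 1 < α) (hC : ∀ w : ℂ, |w.im| ≤ w.re →
    ‖deriv (deriv psi) w‖ ≤ C * Real.exp (-(w.re / 2))) (hC0 : 0 < C)
    (l : ℕ) (z : ℂ) (hz : |z.im| < z.re) (x : ℝ) (hx : 0 < x) (h1 : x / 2 < z.re) (h2 : z.re < 2 * x) :
    ‖gTerm (⌊α * (l + 1)⌋ : ℝ) (Int.fract (α * (l + 1))) z‖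
      ≤ 2 * C * (2 * x * Real.exp (-(((l:ℝ) + 1) * (x / 2) / 2))) := by
  refine (l_bound hα hC hC0 l z hz).trans ?_
  gcongr

lemma u_summable {C : ℝ} (x : ℝ) (hx : 0 < x) :
    Summable (fun l : ℕ => 2 * C * (2 * x * Real.exp (-(((l:ℝ) + 1) * (x / 2) / 2)))) :=
  ((exp_sum (x / 2) (by linarith)).summable.mul_left _).mul_left _

lemma GB_bound
    {α C : ℝ} (hα : 1 < α) (hC : ∀ w : ℂ, |w.im| ≤ w.re →
    ‖deriv (deriv psi) w‖ ≤ C * Real.exp (-(w.re / 2))) (hC0 : 0 < C)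
    (z : ℂ) (hz : |z.im| < z.re) : ‖GB α z‖ ≤ 4 * C := by
  have hzr : 0 < z.re := (abs_nonneg _).trans_lt hz
  refine (tsum_of_norm_bounded (((exp_sum z.re hzr).mul_left z.re).mul_left (2 * C))
    (fun l => l_bound hα hC hC0 l z hz)).trans ?_
  have := exp_sum_le z.re hzr
  nlinarith

lemma GB_diff
    {α C : ℝ} (hα : 1 < α) (hC : ∀ w : ℂ, |w.im| ≤ w.re →
    ‖deriv (deriv psi) w‖ ≤ C * Real.exp (-(w.re / 2))) (hC0 : 0 < C)
    (z : ℂ) (hz : |z.im| < z.re) : DifferentiableAt ℂ (GB α) z := by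
  have hzr : 0 < z.re := (abs_nonneg _).trans_lt hz
  have hU : IsOpen {w : ℂ | |w.im| < w.re ∧ z.re / 2 < w.re ∧ w.re < 2 * z.re} :=
    (isOpen_lt Complex.continuous_im.abs Complex.continuous_re).inter
      ((isOpen_lt continuous_const Complex.continuous_re).inter
        (isOpen_lt Complex.continuous_re continuous_const))
  have := Complex.differentiableOn_tsum_of_summable_norm (u_summable (C := C) z.re hzr)
    (F := fun (l : ℕ) z => gTerm (⌊α * (l + 1)⌋ : ℝ) (Int.fract (α * (l + 1))) z)
    (fun l w hw => (gTerm_diff _ _ (by have := floor_ge hα l; have : (0:ℝ) ≤ l := Nat.cast_nonneg l; linarith)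
      (Int.fract_nonneg _) w hw.1).differentiableWithinAt) hU
    (fun l w hw => l_bound' hα hC hC0 l w hw.1 z.re hzr hw.2.1 hw.2.2)
  exact this.differentiableAt (hU.mem_nhds ⟨hz, by linarith, by linarith⟩)

lemma E_deriv
    {α C : ℝ} (hα : 1 < α) (hC : ∀ w : ℂ, |w.im| ≤ w.re →
    ‖deriv (deriv psi) w‖ ≤ C * Real.exp (-(w.re / 2))) (hC0 : 0 < C)
    (t : ℝ) (ht : 0 < t) : HasDerivAt (EBeatty α) (GB α t).re t := by
  have hs : ∀ y : ℝ, 0 < y → |(y:ℂ).im| < (y:ℂ).re := by intro y hy; simpa using hy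
  have hl : ∀ l : ℕ, (0:ℝ) < (⌊α * (l + 1)⌋ : ℝ) := fun l => by
    have := floor_ge hα l; have : (0:ℝ) ≤ l := Nat.cast_nonneg l; linarith
  have hre : (GB α t).re = ∑' l : ℕ, (gTerm (⌊α * (l + 1)⌋ : ℝ) (Int.fract (α * (l + 1))) t).re := by
    rw [GB, Complex.re_tsum]
    exact Summable.of_norm_bounded (u_summable (C := C) t ht)
      (fun l => l_bound' hα hC hC0 l t (hs t ht) t ht (by simp; linarith) (by simp; linarith))
  rw [hre]
  refine hasDerivAt_tsum_of_isPreconnected (t := Set.Ioo (t/2) (2*t)) (y₀ := t)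
    (g' := fun (l : ℕ) (y : ℝ) => (gTerm (⌊α * (l + 1)⌋ : ℝ) (Int.fract (α * (l + 1))) y).re)
    (u_summable (C := C) t ht) isOpen_Ioo isPreconnected_Ioo
    ?_ ?_ ⟨by linarith, by linarith⟩ ?_ ⟨by linarith, by linarith⟩
  · intro l y hy
    have hy0 : 0 < y := by linarith [hy.1]
    refine (term_deriv (hl l) (Int.fract_nonneg (α * (l + 1))) hy0).congr_of_eventuallyEq ?_
    filter_upwards [lt_mem_nhds hy0] with s hs
    have h := Int.floor_add_fract (α * ((l:ℝ) + 1))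
    have h2 := hl l
    rw [outer_eq (Int.fract_nonneg _) (by linarith) hs, h, Int.self_sub_fract]
  · intro l y hy
    have hy0 : 0 < y := by linarith [hy.1]
    rw [Real.norm_eq_abs]
    exact (Complex.abs_re_le_norm _).trans
      (l_bound' hα hC hC0 l y (hs y hy0) t ht (by simpa using hy.1) (by simpa using hy.2))
  · have hsum : Summable (fun l : ℕ => 1 / ((l:ℝ) + 1) ^ 2) := by
      have := (summable_nat_add_iff 1).2 (Real.summable_one_div_nat_pow.2 (by norm_num : 1 < 2))
      simpa using this
    refine Summable.of_norm_bounded hsum fun l => ?_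
    exact term_bound (Int.fract_nonneg _) (Int.fract_lt_one _).le (by positivity)
      (by rw [Int.self_sub_fract]; exact floor_ge hα l)

lemma E_iter
    {α C : ℝ} (hα : 1 < α) (hC : ∀ w : ℂ, |w.im| ≤ w.re →
    ‖deriv (deriv psi) w‖ ≤ C * Real.exp (-(w.re / 2))) (hC0 : 0 < C)
    (m : ℕ) : ∀ t : ℝ, 0 < t → deriv^[m + 1] (EBeatty α) t = (iteratedDeriv m (GB α) t).re := by
  have hU : IsOpen {w : ℂ | |w.im| < w.re} := isOpen_lt Complex.continuous_im.abs Complex.continuous_re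
  have hd : DifferentiableOn ℂ (GB α) {w : ℂ | |w.im| < w.re} :=
    fun w hw => (GB_diff hα hC hC0 w hw).differentiableWithinAt
  induction m with
  | zero => intro t ht; simpa using (E_deriv hα hC hC0 t ht).deriv
  | succ m ih =>
    intro t ht
    rw [Function.iterate_succ_apply']
    have heq : deriv^[m + 1] (EBeatty α) =ᶠ[𝓝 t] fun t => (iteratedDeriv m (GB α) t).re := by
      filter_upwards [lt_mem_nhds ht] with s hs using ih s hs
    rw [heq.deriv_eq, iteratedDeriv_succ]
    have han : AnalyticAt ℂ (GB α) t := hd.analyticAt (hU.mem_nhds (by simpa using ht))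
    have := (han.iterated_deriv m).differentiableAt.hasDerivAt
    rw [← iteratedDeriv_eq_iterate] at this
    exact this.real_of_complex.deriv

theorem stmt16 (α : ℝ) (hα : 1 < α) (hirr : Irrational α) (k : ℕ) (hk : 1 ≤ k) :
    ∃ C > (0 : ℝ), ∀ᶠ t : ℝ in 𝓝[>] (0 : ℝ),
      |deriv^[k] (EBeatty α) t| ≤ C * t ^ ((1 : ℤ) - k) := by
  obtain ⟨C, hC0, hC⟩ := psi_bound
  obtain ⟨m, rfl⟩ : ∃ m, k = m + 1 := ⟨k - 1, by omega⟩
  refine ⟨m.factorial * (4 * C) * 3 ^ m, by positivity, ?_⟩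
  filter_upwards [self_mem_nhdsWithin] with t ht
  have ht : 0 < t := ht
  rw [E_iter hα hC hC0 m t ht]
  have hball : ∀ w ∈ Metric.closedBall (t:ℂ) (t/3), |w.im| < w.re := by
    intro w hw
    rw [Metric.mem_closedBall, dist_eq_norm] at hw
    have h1 := (Complex.abs_re_le_norm _).trans hw
    have h2 := (Complex.abs_im_le_norm _).trans hw
    simp only [Complex.sub_re, Complex.sub_im, Complex.ofReal_re, Complex.ofReal_im, sub_zero] at h1 h2
    rw [abs_le] at h1
    linarith
  have h := Complex.norm_iteratedDeriv_le_of_forall_mem_sphere_norm_le m (f := GB α) (c := (t:ℂ)) (by positivity : 0 < t/3)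
    (DifferentiableOn.diffContOnCl fun w hw =>
      (GB_diff hα hC hC0 w (hball w (Metric.closure_ball_subset_closedBall hw))).differentiableWithinAt)
    (fun w hw => GB_bound hα hC hC0 w (hball w (Metric.sphere_subset_closedBall hw)))
  refine ((Complex.abs_re_le_norm _).trans h).trans (le_of_eq ?_)
  have : (1:ℤ) - ((m + 1 : ℕ) : ℤ) = -(m:ℤ) := by push_cast; ring
  rw [this, zpow_neg, zpow_natCast, div_pow]
  field_simp
end

section
/- Let α > 1 be an irrational real number. Then as t → 0⁺, the derivatives of R_α satisfy R_α'(t) = o(1/t) and R_α''(t) = O(t^{−2}). -/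
open Filter Topology Real Asymptotics

/-- `R_α(t) = ∑_{ℓ ≥ 1} t·B̃₁(αℓ)/(e^{tαℓ} - 1)`, with `B̃₁(x) = {x} - 1/2`. -/
noncomputable def RBeatty (α : ℝ) (t : ℝ) : ℝ :=
  ∑' ℓ : ℕ, t * (Int.fract (α * (ℓ + 1)) - 1 / 2) / (Real.exp (t * (α * (ℓ + 1))) - 1)

namespace BeattyAux

/-- first derivative of `u/(e^u-1)` -/
noncomputable def phi1 (u : ℝ) : ℝ := (exp u - 1 - u * exp u) / (exp u - 1) ^ 2

/-- second derivative of `u/(e^u-1)` -/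
noncomputable def phi2 (u : ℝ) : ℝ :=
  exp u * (u * exp u + u - 2 * exp u + 2) / (exp u - 1) ^ 3

lemma exp_sub_pos {u : ℝ} (hu : 0 < u) : 0 < exp u - 1 := by
  have := Real.add_one_lt_exp hu.ne'
  linarith

lemma hasDerivAt_phi1 {u : ℝ} (hu : 0 < u) : HasDerivAt phi1 (phi2 u) u := by
  have hE := (exp_sub_pos hu).ne'
  have h1 : HasDerivAt (fun u : ℝ => exp u - 1 - u * exp u)
      (exp u - (1 * exp u + u * exp u)) u :=
    ((Real.hasDerivAt_exp u).sub_const 1).sub ((hasDerivAt_id u).mul (Real.hasDerivAt_exp u))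
  have h2 : HasDerivAt (fun u : ℝ => (exp u - 1) ^ 2) (2 * (exp u - 1) ^ 1 * exp u) u := by
    have := ((Real.hasDerivAt_exp u).sub_const 1).fun_pow 2
    simpa using this
  have h3 := h1.div h2 (pow_ne_zero 2 hE)
  refine h3.congr_deriv ?_
  unfold phi2
  field_simp
  ring

lemma phi_bound {u : ℝ} (hu : 0 < u) : u / (exp u - 1) ≤ 4 * exp (-(3 * u / 4)) := by
  rw [div_le_iff₀ (exp_sub_pos hu)]
  have h1 : exp (-(3 * u / 4)) * exp u = exp (u / 4) := by
    rw [← Real.exp_add]; congr 1; ring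
  have h2 : exp (-(3 * u / 4)) ≤ 1 := Real.exp_le_one_iff.2 (by linarith)
  have h3 := Real.add_one_le_exp (u / 4)
  nlinarith

lemma phi_bound' {u : ℝ} (hu : 0 < u) : u / (exp u - 1) ≤ 4 * exp (-(u / 2)) := by
  refine (phi_bound hu).trans ?_
  have : exp (-(3 * u / 4)) ≤ exp (-(u / 2)) := Real.exp_le_exp.2 (by linarith)
  linarith

lemma phi1_bound {u : ℝ} (hu : 0 < u) : |phi1 u| ≤ 4 * exp (-(u / 2)) := by
  refine le_trans ?_ (phi_bound' hu)
  have hE := exp_sub_pos hu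
  unfold phi1
  rw [abs_div, abs_of_pos (pow_pos hE 2), div_le_div_iff₀ (pow_pos hE 2) hE]
  have h1 := Real.add_one_le_exp u
  have h2 : exp u - 1 - u * exp u ≤ 0 := by
    have := Real.add_one_le_exp (-u)
    have h3 : exp (-u) * exp u = 1 := by rw [← Real.exp_add]; simp
    nlinarith [Real.exp_pos u]
  rw [abs_of_nonpos h2]
  have : -(exp u - 1 - u * exp u) ≤ u * (exp u - 1) := by nlinarith
  calc _ ≤ u * (exp u - 1) * (exp u - 1) := by gcongr
    _ = _ := by ring

lemma num_nonneg {u : ℝ} (hu : 0 ≤ u) : 0 ≤ u * exp u + u - 2 * exp u + 2 := by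
  have hd : ∀ x : ℝ, HasDerivAt (fun u : ℝ => u * exp u + u - 2 * exp u + 2)
      (1 * exp x + x * exp x + 1 - 2 * exp x) x := fun x =>
    ((((hasDerivAt_id x).mul (Real.hasDerivAt_exp x)).add (hasDerivAt_id x)).sub
      ((Real.hasDerivAt_exp x).const_mul 2)).add_const 2
  have hm : Monotone (fun u : ℝ => u * exp u + u - 2 * exp u + 2) := by
    refine monotone_of_deriv_nonneg (fun x => (hd x).differentiableAt) fun x => ?_
    rw [(hd x).deriv]
    have := Real.add_one_le_exp (-x)
    have h3 : exp (-x) * exp x = 1 := by rw [← Real.exp_add]; simp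
    nlinarith [Real.exp_pos x]
  have := hm hu
  simpa using this

lemma num_le {u : ℝ} (hu : 0 ≤ u) :
    u * exp u + u - 2 * exp u + 2 ≤ u ^ 2 / 2 * (exp u - 1) := by
  have hd : ∀ x : ℝ, HasDerivAt
      (fun u : ℝ => u ^ 2 / 2 * (exp u - 1) - (u * exp u + u - 2 * exp u + 2))
      ((2 * x ^ 1 * 1) / 2 * (exp x - 1) + x ^ 2 / 2 * exp x
        - (1 * exp x + x * exp x + 1 - 2 * exp x)) x := fun x => by
    have h1 : HasDerivAt (fun u : ℝ => u ^ 2 / 2) ((2 * x ^ 1 * 1) / 2) x := by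
      simpa using ((hasDerivAt_id x).fun_pow 2).div_const 2
    exact (h1.mul ((Real.hasDerivAt_exp x).sub_const 1)).sub
      (((((hasDerivAt_id x).mul (Real.hasDerivAt_exp x)).add (hasDerivAt_id x)).sub
      ((Real.hasDerivAt_exp x).const_mul 2)).add_const 2)
  have hm : Monotone
      (fun u : ℝ => u ^ 2 / 2 * (exp u - 1) - (u * exp u + u - 2 * exp u + 2)) := by
    refine monotone_of_deriv_nonneg (fun x => (hd x).differentiableAt) fun x => ?_
    rw [(hd x).deriv]
    have := Real.add_one_le_exp x
    nlinarith [mul_nonneg (sq_nonneg x) (Real.exp_pos x).le]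
  have := hm hu
  simp at this
  linarith

lemma phi2_bound {u : ℝ} (hu : 0 < u) : |phi2 u| ≤ 8 * exp (-(u / 2)) := by
  have hE := exp_sub_pos hu
  have h0 : 0 ≤ phi2 u := div_nonneg (mul_nonneg (Real.exp_pos u).le (num_nonneg hu.le))
    (pow_pos hE 3).le
  rw [abs_of_nonneg h0]
  have h1 : phi2 u ≤ exp u / 2 * (u / (exp u - 1)) ^ 2 := by
    unfold phi2
    calc _ ≤ exp u * (u ^ 2 / 2 * (exp u - 1)) / (exp u - 1) ^ 3 := by
          gcongr
          exact num_le hu.le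
      _ = _ := by field_simp
  have h2 : (u / (exp u - 1)) ^ 2 ≤ (4 * exp (-(3 * u / 4))) ^ 2 := by
    have := phi_bound hu
    gcongr
  calc _ ≤ _ := h1
    _ ≤ exp u / 2 * (4 * exp (-(3 * u / 4))) ^ 2 := by gcongr
    _ = 8 * (exp u * (exp (-(3 * u / 4)) * exp (-(3 * u / 4)))) := by ring
    _ = _ := by rw [← Real.exp_add, ← Real.exp_add]; congr 2; ring

/-! ### exponential sums -/

lemma hasSum_exp {c : ℝ} (hc : 0 < c) :
    HasSum (fun n : ℕ => exp (-(c * (n + 1)))) (exp (-c) * (1 - exp (-c))⁻¹) := by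
  have h := (hasSum_geometric_of_lt_one (Real.exp_pos (-c)).le
    ((Real.exp_lt_one_iff.2 (by linarith : -c < 0)))).mul_left (exp (-c))
  refine h.congr_fun ?_ |> id
  intro n
  rw [← Real.exp_nat_mul, ← Real.exp_add]
  congr 1; ring

lemma tsum_exp_le {c : ℝ} (hc : 0 < c) : ∑' n : ℕ, exp (-(c * (n + 1))) ≤ 1 / c := by
  rw [(hasSum_exp hc).tsum_eq, ← div_eq_mul_inv,
    div_le_div_iff₀ (by have := (Real.exp_lt_one_iff.2 (by linarith : -c < 0)); linarith) hc]
  have h1 := Real.add_one_le_exp c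
  have h3 : exp (-c) * exp c = 1 := by rw [← Real.exp_add]; simp
  nlinarith [Real.exp_pos (-c)]

lemma sum_exp_le {c : ℝ} (hc : 0 < c) (N : ℕ) :
    ∑ n ∈ Finset.range N, exp (-(c * (n + 1))) ≤ 1 / c :=
  ((hasSum_exp hc).summable.sum_le_tsum _ (fun _ _ => (Real.exp_pos _).le)).trans
    (tsum_exp_le hc)

/-- `x e^{-ax/2} ≤ (4/a) e^{-ax/4}` -/
lemma mul_exp_le {a x : ℝ} (ha : 0 < a) :
    x * exp (-(a * x / 2)) ≤ 4 / a * exp (-(a * x / 4)) := by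
  have h : exp (-(a * x / 2)) = exp (-(a * x / 4)) * exp (-(a * x / 4)) := by
    rw [← Real.exp_add]; congr 1; ring
  have h2 : x * exp (-(a * x / 4)) ≤ 4 / a := by
    rw [le_div_iff₀ ha]
    have h3 : exp (-(a * x / 4)) * exp (a * x / 4) = 1 := by rw [← Real.exp_add]; simp
    have h1 := Real.add_one_le_exp (a * x / 4)
    nlinarith [Real.exp_pos (-(a * x / 4))]
  rw [h, ← mul_assoc]
  gcongr

/-! ### equidistribution -/

lemma telescope (H : ℕ → ℝ) (hH : ∀ i j, |H i - H j| ≤ 1) (q N : ℕ) :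
    |∑ k ∈ Finset.range N, (H (k + q) - H k)| ≤ q := by
  have h : ∑ k ∈ Finset.range N, (H (k + q) - H k)
      = ∑ k ∈ Finset.range q, (H (N + k) - H k) := by
    rw [Finset.sum_sub_distrib, Finset.sum_sub_distrib]
    have h1 := Finset.sum_range_add H q N
    have h2 := Finset.sum_range_add H N q
    rw [add_comm q N] at h1
    have h3 : ∑ k ∈ Finset.range N, H (k + q) = ∑ k ∈ Finset.range N, H (q + k) :=
      Finset.sum_congr rfl fun k _ => by rw [add_comm]
    rw [h3]
    linarith
  rw [h]
  refine (Finset.abs_sum_le_sum_abs _ _).trans ?_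
  refine (Finset.sum_le_sum fun k _ => hH (N + k) k).trans ?_
  simp

noncomputable def bb (β : ℝ) (k : ℕ) : ℝ := Int.fract (β * (k + 1)) - 1 / 2

lemma abs_bb (β : ℝ) (k : ℕ) : |bb β k| ≤ 1 / 2 := by
  have h1 := Int.fract_nonneg (β * (k + 1))
  have h2 := Int.fract_lt_one (β * (k + 1))
  unfold bb
  rw [abs_le]; constructor <;> linarith

lemma step (y z δ : ℝ) (hy0 : 0 ≤ y) (hy1 : y < 1) (hz0 : 0 ≤ z) 
    (hδ0 : 0 ≤ δ) (h : z = y + δ ∨ z = y + δ - 1) :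
    |δ * (y - 1 / 2) - ((z ^ 2 - z) / 2 - (y ^ 2 - y) / 2)| ≤ δ ^ 2 / 2 + δ * (y + δ - z) := by
  rcases h with h | h
  · subst h
    rw [abs_le]; constructor <;> nlinarith [sq_nonneg δ]
  · have e : δ * (y - 1 / 2) - ((z ^ 2 - z) / 2 - (y ^ 2 - y) / 2) = z - δ ^ 2 / 2 := by
      subst h; ring
    rw [e, show y + δ - z = 1 by linarith, abs_le]
    constructor <;> nlinarith [sq_nonneg δ]

lemma disc (β : ℝ) (q : ℕ) (hδ : 0 < Int.fract (β * q)) (N : ℕ) :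
    |∑ k ∈ Finset.range N, bb β k| ≤
      3 / 2 * Int.fract (β * q) * N + (q / Int.fract (β * q) + q) := by
  set δ := Int.fract (β * q) with hδdef
  set y : ℕ → ℝ := fun k => Int.fract (β * (k + 1)) with hy
  have y0 : ∀ k, 0 ≤ y k := fun k => Int.fract_nonneg _
  have y1 : ∀ k, y k < 1 := fun k => Int.fract_lt_one _
  have hδ1 : δ < 1 := Int.fract_lt_one _
  set G : ℕ → ℝ := fun k => (y k ^ 2 - y k) / 2 with hG
  have hw : ∀ k, y (k + q) = y k + δ ∨ y (k + q) = y k + δ - 1 := by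
    intro k
    have e : β * ((k + q : ℕ) + 1) = β * (k + 1) + β * q := by push_cast; ring
    obtain ⟨z, hz⟩ := Int.fract_add (β * (k + 1)) (β * q)
    rw [← e] at hz
    change y (k + q) - y k - δ = z at hz
    have a1 := y0 k
    have a2 := y1 k
    have a3 := y0 (k + q)
    have a4 := y1 (k + q)
    have b1 : (-2 : ℝ) < z := by linarith
    have b2 : (z : ℝ) < 1 := by linarith
    have b1' : -2 < z := by exact_mod_cast b1
    have b2' : z < 1 := by exact_mod_cast b2
    have : z = 0 ∨ z = -1 := by omega
    rcases this with h | h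
    · left; rw [h] at hz; push_cast at hz; linarith
    · right; rw [h] at hz; push_cast at hz; linarith
  have hs : ∀ k, |δ * bb β k - (G (k + q) - G k)| ≤ δ ^ 2 / 2 + δ * (y k + δ - y (k + q)) :=
    fun k => step (y k) (y (k + q)) δ (y0 k) (y1 k) (y0 _) hδ.le (hw k)
  have tG := telescope G (fun i j => by
    have := y0 i; have := y1 i; have := y0 j; have := y1 j
    simp only [hG]; rw [abs_le]; constructor <;> nlinarith) q N
  have tY := telescope y (fun i j => by
    have := y0 i; have := y1 i; have := y0 j; have := y1 j
    rw [abs_le]; constructor <;> linarith) q N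
  have hsum : |δ * (∑ k ∈ Finset.range N, bb β k)
      - ∑ k ∈ Finset.range N, (G (k + q) - G k)|
      ≤ N * (δ ^ 2 / 2) + δ * (N * δ - ∑ k ∈ Finset.range N, (y (k + q) - y k)) := by
    rw [Finset.mul_sum, ← Finset.sum_sub_distrib]
    refine (Finset.abs_sum_le_sum_abs _ _).trans
      ((Finset.sum_le_sum fun k _ => hs k).trans (le_of_eq ?_))
    rw [Finset.sum_add_distrib, ← Finset.mul_sum]
    simp only [Finset.sum_sub_distrib, Finset.sum_add_distrib, Finset.sum_const,
      Finset.card_range, nsmul_eq_mul]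
    ring
  have key : δ * |∑ k ∈ Finset.range N, bb β k| ≤ q + 3 / 2 * N * δ ^ 2 + δ * q := by
    rw [← abs_of_pos hδ, ← abs_mul, abs_of_pos hδ]
    rw [abs_le] at tG tY hsum ⊢
    have := mul_le_mul_of_nonneg_left tY.1 hδ.le
    constructor <;> nlinarith
  have e : 3 / 2 * δ * N + (q / δ + q) = (q + 3 / 2 * N * δ ^ 2 + δ * q) / δ := by
    field_simp; ring
  rw [e, le_div_iff₀ hδ, mul_comm]
  exact key

lemma bb_neg {β : ℝ} (hirr : Irrational β) (k : ℕ) : bb (-β) k = - bb β k := by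
  have h : Irrational (β * (k + 1)) := by
    have := hirr.mul_natCast (Nat.succ_ne_zero k)
    simpa using this
  have h0 : Int.fract (β * (k + 1)) ≠ 0 := by
    intro h0
    rw [Int.fract_eq_zero_iff] at h0
    obtain ⟨z, hz⟩ := h0
    exact h.ne_int z hz.symm
  unfold bb
  rw [neg_mul, Int.fract_neg h0]
  ring

lemma equi {β : ℝ} (hirr : Irrational β) {ε : ℝ} (hε : 0 < ε) :
    ∃ K : ℝ, 0 ≤ K ∧ ∀ N : ℕ, |∑ k ∈ Finset.range N, bb β k| ≤ ε * N + K := by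
  obtain ⟨n, hn⟩ := exists_nat_gt (max (2 / ε) 1)
  have hn1 : (1 : ℝ) < n := (le_max_right _ _).trans_lt hn
  have hnε : 2 / ε < n := (le_max_left _ _).trans_lt hn
  have hnpos : 0 < n := by
    have : (0 : ℝ) < n := by linarith
    exact_mod_cast this
  obtain ⟨p, q, hq0, -, hpq⟩ := Real.exists_int_int_abs_mul_sub_le β hnpos
  lift q to ℕ using hq0.le
  have hq0' : q ≠ 0 := by rintro rfl; simp at hq0
  have hsmall : |β * q - p| < ε / 2 := by
    rw [mul_comm]
    have h2 : (1 : ℝ) / (n + 1) < ε / 2 := by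
      rw [div_lt_div_iff₀ (by linarith) (by norm_num)]
      rw [div_lt_iff₀ hε] at hnε
      nlinarith
    exact lt_of_le_of_lt (by simpa using hpq) h2
  have hsmall1 : |β * q - p| < 1 := by
    have h2 : (1 : ℝ) / (n + 1) < 1 := by
      rw [div_lt_one (by linarith)]; linarith
    rw [mul_comm]
    exact lt_of_le_of_lt (by simpa using hpq) h2
  have hne : β * q - p ≠ 0 := by
    intro h
    exact (hirr.mul_natCast hq0').ne_int p (by linarith)
  rcases lt_or_gt_of_ne hne with h | h
  · rw [abs_of_neg h] at hsmall hsmall1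
    have hf : Int.fract (-β * q) = -(β * q - p) := by
      rw [Int.fract_eq_iff]
      exact ⟨by linarith, hsmall1, -p, by push_cast; ring⟩
    have hd := disc (-β) q (by rw [hf]; linarith)
    refine ⟨q / Int.fract (-β * q) + q, ?_, fun N => ?_⟩
    rotate_left
    · have := hd N
      simp only [bb_neg hirr, Finset.sum_neg_distrib, abs_neg] at this
      refine this.trans ?_
      gcongr
      rw [hf]; linarith
    · have := Int.fract_nonneg (-β * q)
      positivity
  · rw [abs_of_pos h] at hsmall hsmall1
    have hf : Int.fract (β * q) = (β * q - p) := by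
      rw [Int.fract_eq_iff]
      exact ⟨by linarith, hsmall1, p, by ring⟩
    have hd := disc β q (by rw [hf]; linarith)
    refine ⟨q / Int.fract (β * q) + q, ?_, fun N => ?_⟩
    rotate_left
    · refine (hd N).trans ?_
      gcongr
      rw [hf]; linarith
    · have := Int.fract_nonneg (β * q)
      positivity

/-! ### derivatives of the series -/

lemma xpos {α : ℝ} (hα : 1 < α) (n : ℕ) : 0 < α * ((n : ℝ) + 1) := by positivity

lemma hasDerivAt_term {α : ℝ} (hα : 1 < α) (n : ℕ) {t : ℝ} (ht : 0 < t) :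
    HasDerivAt (fun t : ℝ => t * (Int.fract (α * ((n : ℝ) + 1)) - 1 / 2) /
      (Real.exp (t * (α * ((n : ℝ) + 1))) - 1)) (bb α n * phi1 (t * (α * ((n : ℝ) + 1)))) t := by
  have hx := xpos hα n
  unfold bb
  generalize Int.fract (α * ((n : ℝ) + 1)) - 1 / 2 = b
  revert hx
  generalize α * ((n : ℝ) + 1) = x
  intro hx
  have hE := (exp_sub_pos (mul_pos ht hx)).ne'
  have h1 : HasDerivAt (fun t : ℝ => t * b) b t := by
    simpa using (hasDerivAt_id t).mul_const b
  have h2 : HasDerivAt (fun t : ℝ => exp (t * x) - 1) (exp (t * x) * x) t := by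
    have : HasDerivAt (fun t : ℝ => t * x) x t := by
      simpa using (hasDerivAt_id t).mul_const x
    exact this.exp.sub_const 1
  refine (h1.div h2 hE).congr_deriv ?_
  unfold phi1
  field_simp

lemma hasDerivAt_term1 {α : ℝ} (hα : 1 < α) (n : ℕ) {t : ℝ} (ht : 0 < t) :
    HasDerivAt (fun t : ℝ => bb α n * phi1 (t * (α * ((n : ℝ) + 1))))
      (bb α n * (phi2 (t * (α * ((n : ℝ) + 1))) * (α * ((n : ℝ) + 1)))) t := by
  have hx := xpos hα n
  have : HasDerivAt (fun t : ℝ => t * (α * ((n : ℝ) + 1))) (α * ((n : ℝ) + 1)) t := by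
    simpa using (hasDerivAt_id t).mul_const (α * ((n : ℝ) + 1))
  exact ((hasDerivAt_phi1 (mul_pos ht hx)).comp t this).const_mul _

lemma bound1 {α : ℝ} (hα : 1 < α) (n : ℕ) {a t : ℝ} (ha : 0 < a) (ht : a ≤ t) :
    ‖bb α n * phi1 (t * (α * ((n : ℝ) + 1)))‖ ≤ 2 * exp (-((a * α / 2) * (n + 1))) := by
  have hx := xpos hα n
  have ht0 := ha.trans_le ht
  rw [Real.norm_eq_abs, abs_mul]
  calc _ ≤ 1 / 2 * (4 * exp (-(t * (α * ((n : ℝ) + 1)) / 2))) :=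
        mul_le_mul (abs_bb α n) (phi1_bound (mul_pos ht0 hx)) (abs_nonneg _) (by norm_num)
    _ = 2 * exp (-(t * (α * ((n : ℝ) + 1)) / 2)) := by ring
    _ ≤ 2 * exp (-(a * (α * ((n : ℝ) + 1)) / 2)) := by gcongr
    _ = _ := by congr 2; ring

lemma bound2 {α : ℝ} (hα : 1 < α) (n : ℕ) {a t : ℝ} (ha : 0 < a) (ht : a ≤ t) :
    ‖bb α n * (phi2 (t * (α * ((n : ℝ) + 1))) * (α * ((n : ℝ) + 1)))‖
      ≤ 16 / a * exp (-((a * α / 4) * (n + 1))) := by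
  have hx := xpos hα n
  have ht0 := ha.trans_le ht
  rw [Real.norm_eq_abs, abs_mul, abs_mul, abs_of_pos hx]
  calc _ ≤ 1 / 2 * ((8 * exp (-(t * (α * ((n : ℝ) + 1)) / 2))) * (α * ((n : ℝ) + 1))) := by
        have h1 := abs_bb α n
        have h2 := phi2_bound (mul_pos ht0 hx)
        gcongr
    _ ≤ 1 / 2 * ((8 * exp (-(a * (α * ((n : ℝ) + 1)) / 2))) * (α * ((n : ℝ) + 1))) := by gcongr
    _ = 4 * ((α * ((n : ℝ) + 1)) * exp (-(a * (α * ((n : ℝ) + 1)) / 2))) := by ring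
    _ ≤ 4 * (4 / a * exp (-(a * (α * ((n : ℝ) + 1)) / 4))) := by
        gcongr 4 * ?_
        exact mul_exp_le ha
    _ = 16 / a * exp (-(a * (α * ((n : ℝ) + 1)) / 4)) := by ring
    _ = _ := by congr 2; ring

lemma summable0 {α : ℝ} (hα : 1 < α) {t : ℝ} (ht : 0 < t) :
    Summable (fun n : ℕ => t * (Int.fract (α * ((n : ℝ) + 1)) - 1 / 2) /
      (Real.exp (t * (α * ((n : ℝ) + 1))) - 1)) := by
  have hc : 0 < t * α / 2 := by positivity
  refine Summable.of_norm_bounded ((hasSum_exp hc).summable.mul_left 2) fun n => ?_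
  have hx := xpos hα n
  have hx1 : 1 ≤ α * ((n : ℝ) + 1) := by
    have : (0 : ℝ) ≤ n := n.cast_nonneg
    nlinarith
  have hE := exp_sub_pos (mul_pos ht hx)
  have hb := abs_bb α n
  unfold bb at hb
  rw [Real.norm_eq_abs, abs_div, abs_mul, abs_of_pos hE, abs_of_pos ht]
  calc _ ≤ (t * (α * ((n : ℝ) + 1))) * (1 / 2) / (Real.exp (t * (α * ((n : ℝ) + 1))) - 1) := by
        gcongr
        nlinarith
    _ = 1 / 2 * ((t * (α * ((n : ℝ) + 1))) / (Real.exp (t * (α * ((n : ℝ) + 1))) - 1)) := by ring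
    _ ≤ 1 / 2 * (4 * exp (-((t * (α * ((n : ℝ) + 1))) / 2))) := by
        have := phi_bound' (mul_pos ht hx)
        gcongr
    _ = 2 * exp (-((t * (α * ((n : ℝ) + 1))) / 2)) := by ring
    _ = _ := by congr 2; ring

lemma summable1 {α : ℝ} (hα : 1 < α) {t : ℝ} (ht : 0 < t) :
    Summable (fun n : ℕ => bb α n * phi1 (t * (α * ((n : ℝ) + 1)))) :=
  Summable.of_norm_bounded ((hasSum_exp (by positivity : 0 < t * α / 2)).summable.mul_left 2)
    fun n => bound1 hα n ht le_rfl

lemma deriv_R {α : ℝ} (hα : 1 < α) {t : ℝ} (ht : 0 < t) :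
    deriv (RBeatty α) t = ∑' n : ℕ, bb α n * phi1 (t * (α * ((n : ℝ) + 1))) := by
  have ha : 0 < t / 2 := by positivity
  refine HasDerivAt.deriv ?_
  exact hasDerivAt_tsum_of_isPreconnected (t := Set.Ioi (t / 2))
    (u := fun n : ℕ => 2 * exp (-((t / 2 * α / 2) * (n + 1)))) (y₀ := t)
    ((hasSum_exp (by positivity)).summable.mul_left 2) isOpen_Ioi isPreconnected_Ioi
    (fun n y hy => hasDerivAt_term hα n (ha.trans hy))
    (fun n y hy => bound1 hα n ha (le_of_lt hy)) (Set.mem_Ioi.2 (by linarith)) (summable0 hα ht)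
    (Set.mem_Ioi.2 (by linarith))

lemma deriv2_R {α : ℝ} (hα : 1 < α) {t : ℝ} (ht : 0 < t) :
    deriv (deriv (RBeatty α)) t =
      ∑' n : ℕ, bb α n * (phi2 (t * (α * ((n : ℝ) + 1))) * (α * ((n : ℝ) + 1))) := by
  have ha : 0 < t / 2 := by positivity
  have he : deriv (RBeatty α) =ᶠ[𝓝 t]
      fun t => ∑' n : ℕ, bb α n * phi1 (t * (α * ((n : ℝ) + 1))) := by
    filter_upwards [Ioi_mem_nhds ht] with s hs
    exact deriv_R hα hs
  rw [he.deriv_eq]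
  refine HasDerivAt.deriv ?_
  exact hasDerivAt_tsum_of_isPreconnected (t := Set.Ioi (t / 2))
    (u := fun n : ℕ => 16 / (t / 2) * exp (-((t / 2 * α / 4) * (n + 1)))) (y₀ := t)
    ((hasSum_exp (by positivity)).summable.mul_left _) isOpen_Ioi isPreconnected_Ioi
    (fun n y hy => hasDerivAt_term1 hα n (ha.trans hy))
    (fun n y hy => bound2 hα n ha (le_of_lt hy)) (Set.mem_Ioi.2 (by linarith)) (summable1 hα ht)
    (Set.mem_Ioi.2 (by linarith))

lemma abs_deriv2_R {α : ℝ} (hα : 1 < α) {t : ℝ} (ht : 0 < t) :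
    |deriv (deriv (RBeatty α)) t| ≤ 64 * t ^ (-2 : ℤ) := by
  rw [deriv2_R hα ht]
  have hc : 0 < t * α / 4 := by positivity
  have h := tsum_of_norm_bounded ((hasSum_exp hc).summable.hasSum.mul_left (16 / t))
    (fun n => bound2 hα n ht le_rfl)
  refine h.trans ?_
  calc _ ≤ 16 / t * (1 / (t * α / 4)) := by
        gcongr
        exact tsum_exp_le hc
    _ ≤ 16 / t * (1 / (t * 1 / 4)) := by gcongr
    _ = 64 * t ^ (-2 : ℤ) := by
        rw [zpow_neg]
        have : t ^ (2 : ℤ) = t ^ 2 := by norm_cast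
        rw [this]
        field_simp
        norm_num

lemma phi1_diff {u h : ℝ} (hu : 0 < u) (hh : 0 ≤ h) :
    |phi1 u - phi1 (u + h)| ≤ 8 * exp (-(u / 2)) * h := by
  have := (convex_Ici u).norm_image_sub_le_of_norm_hasDerivWithin_le
    (f := phi1) (f' := phi2) (C := 8 * exp (-(u / 2))) (x := u + h) (y := u)
    (fun x hx => (hasDerivAt_phi1 (hu.trans_le hx)).hasDerivWithinAt)
    (fun x hx => by
      have hx' : u ≤ x := hx
      refine (phi2_bound (hu.trans_le hx)).trans ?_
      gcongr)
    (Set.mem_Ici.2 (by linarith)) (Set.mem_Ici.2 le_rfl)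
  simpa [Real.norm_eq_abs, abs_of_nonneg hh] using this

lemma abel (b f : ℕ → ℝ) (N : ℕ) :
    ∑ n ∈ Finset.range N, b n * f n = (∑ k ∈ Finset.range N, b k) * f N
      + ∑ n ∈ Finset.range N, (∑ k ∈ Finset.range (n + 1), b k) * (f n - f (n + 1)) := by
  induction N with
  | zero => simp
  | succ N ih =>
    rw [Finset.sum_range_succ, ih, Finset.sum_range_succ _ N]
    simp only [Finset.sum_range_succ]
    ring

lemma abs_deriv_R {α : ℝ} (hα : 1 < α) {ε K : ℝ} (hε : 0 < ε) (hK : 0 ≤ K)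
    (hS : ∀ N : ℕ, |∑ k ∈ Finset.range N, bb α k| ≤ ε * N + K) {t : ℝ} (ht : 0 < t) :
    |deriv (RBeatty α) t| ≤ 136 * ε / t + 20 * K := by
  rw [deriv_R hα ht]
  have hlim := (summable1 hα ht).hasSum.tendsto_sum_nat.abs
  refine le_of_tendsto hlim (Eventually.of_forall fun N => ?_)
  set c := t * α with hc
  have hc0 : 0 < c := by positivity
  have hct : t ≤ c := by nlinarith
  set f : ℕ → ℝ := fun n => phi1 (t * (α * ((n : ℝ) + 1))) with hf
  have hfx : ∀ n : ℕ, f n = phi1 (c * ((n : ℝ) + 1)) := fun n => by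
    simp only [hf, hc]; congr 1; ring
  have hA := abel (bb α) f N
  change |∑ n ∈ Finset.range N, bb α n * f n| ≤ _
  rw [hA]
  have h1 : |(∑ k ∈ Finset.range N, bb α k) * f N| ≤ 8 * ε / c + 4 * K := by
    rw [abs_mul]
    have hN : 0 < c * ((N : ℝ) + 1) := by positivity
    have hfN : |f N| ≤ 4 * exp (-(c * ((N : ℝ) + 1) / 2)) := by
      rw [hfx]; exact phi1_bound hN
    have hle1 : exp (-(c * ((N : ℝ) + 1) / 2)) ≤ 1 := Real.exp_le_one_iff.2 (by linarith)
    have hNe : (N : ℝ) * exp (-(c * ((N : ℝ) + 1) / 2)) ≤ 2 / c := by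
      rw [le_div_iff₀ hc0]
      have h3 : exp (-(c * ((N : ℝ) + 1) / 2)) * exp (c * ((N : ℝ) + 1) / 2) = 1 := by
        rw [← Real.exp_add]; simp
      have h4 := Real.add_one_le_exp (c * ((N : ℝ) + 1) / 2)
      nlinarith [Real.exp_pos (-(c * ((N : ℝ) + 1) / 2))]
    calc _ ≤ (ε * N + K) * (4 * exp (-(c * ((N : ℝ) + 1) / 2))) :=
          mul_le_mul (hS N) hfN (abs_nonneg _) (by positivity)
      _ = 4 * ε * (N * exp (-(c * ((N : ℝ) + 1) / 2)))
          + 4 * K * exp (-(c * ((N : ℝ) + 1) / 2)) := by ring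
      _ ≤ 4 * ε * (2 / c) + 4 * K * 1 := by gcongr
      _ = _ := by ring
  have h2 : |∑ n ∈ Finset.range N, (∑ k ∈ Finset.range (n + 1), bb α k) * (f n - f (n + 1))|
      ≤ 128 * ε / c + 16 * K := by
    refine (Finset.abs_sum_le_sum_abs _ _).trans ?_
    have hterm : ∀ n ∈ Finset.range N,
        |(∑ k ∈ Finset.range (n + 1), bb α k) * (f n - f (n + 1))| ≤
        32 * ε * exp (-((c / 4) * (n + 1))) + 8 * K * c * exp (-((c / 2) * (n + 1))) := by
      intro n _
      have hn : 0 < c * ((n : ℝ) + 1) := by positivity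
      have hd : |f n - f (n + 1)| ≤ 8 * exp (-(c * ((n : ℝ) + 1) / 2)) * c := by
        have := phi1_diff hn hc0.le
        rw [hfx, hfx]
        convert this using 4
        push_cast; ring
      have hSn := hS (n + 1)
      push_cast at hSn
      rw [abs_mul]
      have hm := mul_exp_le (x := (n : ℝ) + 1) hc0
      calc _ ≤ (ε * ((n : ℝ) + 1) + K) * (8 * exp (-(c * ((n : ℝ) + 1) / 2)) * c) :=
            mul_le_mul hSn hd (abs_nonneg _) (by positivity)
        _ = 8 * ε * c * (((n : ℝ) + 1) * exp (-(c * ((n : ℝ) + 1) / 2)))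
            + 8 * K * c * exp (-(c * ((n : ℝ) + 1) / 2)) := by ring
        _ ≤ 8 * ε * c * (4 / c * exp (-(c * ((n : ℝ) + 1) / 4)))
            + 8 * K * c * exp (-(c * ((n : ℝ) + 1) / 2)) := by gcongr
        _ = 32 * ε * exp (-(c * ((n : ℝ) + 1) / 4))
            + 8 * K * c * exp (-(c * ((n : ℝ) + 1) / 2)) := by field_simp; ring
        _ = _ := by
            rw [show c * ((n : ℝ) + 1) / 4 = c / 4 * (n + 1) by ring,
              show c * ((n : ℝ) + 1) / 2 = c / 2 * (n + 1) by ring]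
    refine (Finset.sum_le_sum hterm).trans ?_
    rw [Finset.sum_add_distrib, ← Finset.mul_sum, ← Finset.mul_sum]
    calc _ ≤ 32 * ε * (1 / (c / 4)) + 8 * K * c * (1 / (c / 2)) := by
          have a1 := sum_exp_le (by positivity : 0 < c / 4) N
          have a2 := sum_exp_le (by positivity : 0 < c / 2) N
          gcongr
      _ = _ := by field_simp; ring
  calc _ ≤ (8 * ε / c + 4 * K) + (128 * ε / c + 16 * K) :=
        (abs_add_le _ _).trans (add_le_add h1 h2)
    _ = 136 * ε / c + 20 * K := by ring
    _ ≤ _ := by gcongr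

end BeattyAux

open BeattyAux in
theorem stmt17 (α : ℝ) (hα : 1 < α) (hirr : Irrational α) :
    ((fun t : ℝ => deriv (RBeatty α) t) =o[𝓝[>] (0 : ℝ)] (fun t => 1 / t)) ∧
    ((fun t : ℝ => deriv (deriv (RBeatty α)) t) =O[𝓝[>] (0 : ℝ)] (fun t => t ^ (-2 : ℤ))) := by
  constructor
  · rw [isLittleO_iff]
    intro η hη
    obtain ⟨K, hK, hS⟩ := equi hirr (by positivity : 0 < η / 272)
    have hmem : Set.Ioo (0 : ℝ) (η / (40 * (K + 1))) ∈ 𝓝[>] (0 : ℝ) :=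
      Ioo_mem_nhdsGT (by positivity)
    filter_upwards [hmem] with t ht
    obtain ⟨ht0, ht1⟩ := ht
    have h := abs_deriv_R hα (by positivity) hK hS ht0
    rw [Real.norm_eq_abs, Real.norm_eq_abs, abs_of_pos (by positivity : 0 < 1 / t)]
    refine h.trans ?_
    rw [lt_div_iff₀ (by positivity)] at ht1
    have : 136 * (η / 272) / t + 20 * K = (η / 2 + 20 * K * t) / t := by field_simp; ring
    rw [this, mul_one_div]
    gcongr
    nlinarith
  · refine IsBigO.of_bound 64 ?_
    filter_upwards [self_mem_nhdsWithin] with t ht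
    have ht0 : 0 < t := ht
    rw [Real.norm_eq_abs, Real.norm_eq_abs, abs_of_pos (by positivity : 0 < t ^ (-2 : ℤ))]
    exact abs_deriv2_R hα ht0
end

section
/- Let α > 1 be an irrational real number. Then as t → 0⁺, R_α(t) = o(|log t|) and R_α(t) − R_α(2t) = o(1). -/
open Filter Topology Real Asymptotics

theorem abel (b c : ℕ → ℝ) (ε C : ℝ) (hS : ∀ n : ℕ, |∑ i ∈ Finset.range n, b i| ≤ ε * n + C)
    (hc : Antitone c) (hc0 : ∀ i, 0 ≤ c i) (N : ℕ) :
    |∑ i ∈ Finset.range N, b i * c i| ≤ ε * ∑ i ∈ Finset.range N, c i + C * c 0 := by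
  have key : ∀ N : ℕ, |∑ i ∈ Finset.range N, b i * c i - (∑ i ∈ Finset.range N, b i) * c N| ≤
      ε * ∑ i ∈ Finset.range N, c i + C * c 0 - (ε * N + C) * c N := by
    intro N
    induction N with
    | zero => simp
    | succ N ih =>
      have h1 := hS (N+1)
      have h2 : 0 ≤ c N - c (N+1) := sub_nonneg.2 (hc (Nat.le_succ N))
      have h3 := mul_le_mul_of_nonneg_right h1 h2
      rw [← abs_of_nonneg h2, ← abs_mul, abs_of_nonneg h2] at h3
      have h4 := abs_add_le (∑ i ∈ Finset.range N, b i * c i - (∑ i ∈ Finset.range N, b i) * c N)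
        ((∑ i ∈ Finset.range (N+1), b i) * (c N - c (N+1)))
      have e : ∑ i ∈ Finset.range (N+1), b i * c i - (∑ i ∈ Finset.range (N+1), b i) * c (N+1)
        = (∑ i ∈ Finset.range N, b i * c i - (∑ i ∈ Finset.range N, b i) * c N) +
        ((∑ i ∈ Finset.range (N+1), b i) * (c N - c (N+1))) := by
        simp only [Finset.sum_range_succ]; ring
      rw [e]
      refine h4.trans ((add_le_add ih h3).trans (le_of_eq ?_))
      simp only [Finset.sum_range_succ]; push_cast; ring
  have h1 := key N
  have h3 := mul_le_mul_of_nonneg_right (hS N) (hc0 N)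
  rw [← abs_of_nonneg (hc0 N), ← abs_mul, abs_of_nonneg (hc0 N)] at h3
  have h4 := abs_add_le (∑ i ∈ Finset.range N, b i * c i - (∑ i ∈ Finset.range N, b i) * c N)
        ((∑ i ∈ Finset.range N, b i) * c N)
  rw [sub_add_cancel] at h4
  linarith

theorem perm_sum (p m : ℤ) (q : ℕ) (hq : 0 < q) (hpq : IsCoprime p (q:ℤ)) (f : ℤ → ℝ) :
    ∑ j ∈ Finset.range q, f ((m + j * p) % q) = ∑ j ∈ Finset.range q, f j := by
  have hq' : (0:ℤ) < q := by exact_mod_cast hq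
  have hmap : ∀ j ∈ Finset.range q, ((m + j * p) % q).toNat ∈ Finset.range q := by
    intro j _
    have h1 := Int.emod_nonneg (m + j * p) hq'.ne'
    have h2 := Int.emod_lt_of_pos (m + j * p) hq'
    simp only [Finset.mem_range]; omega
  have hinj : Set.InjOn (fun j : ℕ => ((m + j * p) % q).toNat) (Finset.range q) := by
    intro a ha b hb hab
    simp only [Finset.coe_range, Set.mem_Iio] at ha hb hab
    have h1 := Int.emod_nonneg (m + a * p) hq'.ne'
    have h2 := Int.emod_nonneg (m + b * p) hq'.ne'
    have h3 : (m + a * p) % (q:ℤ) = (m + b * p) % q := by omega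
    have h4 := Int.ModEq.dvd h3
    have h5 : (q:ℤ) ∣ p * ((b:ℤ) - a) := by convert h4 using 1; ring
    have h6 := (hpq.symm).dvd_of_dvd_mul_left h5
    have h7 := Int.eq_zero_of_abs_lt_dvd h6 (by rw [abs_lt]; constructor <;> omega)
    omega
  refine Finset.sum_nbij (fun j : ℕ => ((m + j * p) % q).toNat) hmap hinj
    (Finset.surjOn_of_injOn_of_card_le _ hmap hinj le_rfl) ?_
  intro j _
  rw [Int.toNat_of_nonneg (Int.emod_nonneg _ hq'.ne')]

theorem fract_sum (p : ℤ) (q : ℕ) (hq : 0 < q) (hpq : IsCoprime p (q:ℤ)) (z : ℝ) :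
    ∃ θ : ℝ, 0 ≤ θ ∧ θ < 1 ∧
    ∑ j ∈ Finset.range q, Int.fract (z + j * (p / q)) = θ + (q - 1) / 2 := by
  have hq' : (0:ℤ) < q := by exact_mod_cast hq
  have hqr : (0:ℝ) < q := by exact_mod_cast hq
  refine ⟨Int.fract (q * z), Int.fract_nonneg _, Int.fract_lt_one _, ?_⟩
  have h : ∀ j : ℕ, Int.fract (z + j * (p / q)) =
      (fun a : ℤ => ((a:ℝ) + Int.fract (q * z)) / q) ((⌊q * z⌋ + j * p) % q) := by
    intro j
    have h1 := Int.emod_nonneg (⌊q * z⌋ + j * p) hq'.ne'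
    have h2 := Int.emod_lt_of_pos (⌊q * z⌋ + j * p) hq'
    have h3 := Int.emod_add_mul_ediv (⌊q * z⌋ + j * p) q
    set a := (⌊q * z⌋ + j * p) % (q:ℤ)
    set d := (⌊q * z⌋ + j * p) / (q:ℤ)
    have h1' : (0:ℝ) ≤ a := by exact_mod_cast h1
    have h2' : (a:ℝ) + 1 ≤ q := by exact_mod_cast h2
    have h3' : (a:ℝ) + q * d = ⌊q * z⌋ + j * p := by exact_mod_cast h3
    have f0 := Int.fract_nonneg (q * z)
    have f1 := Int.fract_lt_one (q * z)
    have f2 := Int.floor_add_fract (q * z)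
    rw [Int.fract_eq_iff]
    refine ⟨by positivity, ?_, d, ?_⟩
    · simp only []; rw [div_lt_one hqr]; linarith
    · simp only []
      rw [eq_comm, eq_sub_iff_add_eq]
      have h5 : (z + j * ((p:ℝ) / q)) = (q * z + j * p) / q := by
        rw [add_div, mul_div_cancel_left₀ _ hqr.ne', mul_div_assoc]
      rw [h5, eq_div_iff hqr.ne', add_mul, div_mul_cancel₀ _ hqr.ne']
      linarith
  rw [Finset.sum_congr rfl (fun j _ => h j), perm_sum p ⌊q * z⌋ q hq hpq
    (fun a : ℤ => ((a:ℝ) + Int.fract (q * z)) / q), ← Finset.sum_div,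
    Finset.sum_add_distrib]
  have g : ∀ n : ℕ, ∑ j ∈ Finset.range n, (((j:ℕ):ℤ):ℝ) = n * (n - 1) / 2 := by
    intro n
    induction n with
    | zero => simp
    | succ n ih => rw [Finset.sum_range_succ, ih]; push_cast; ring
  rw [g]
  simp
  field_simp
  ring

theorem block (α : ℝ) (p : ℤ) (q : ℕ) (hq : 0 < q) (hpq : IsCoprime p (q:ℤ))
    (h : |α - p / q| ≤ 1 / (q * q)) (x : ℝ) :
    |∑ j ∈ Finset.range q, (Int.fract (x + j * α) - 1 / 2)| ≤ 4 := by
  have hqr : (0:ℝ) < q := by exact_mod_cast hq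
  have hd : ∀ j ∈ Finset.range q, |(j:ℝ) * α - j * (p / q)| ≤ 1 / q := by
    intro j hj
    have : (j:ℝ) ≤ q := by exact_mod_cast (Finset.mem_range.1 hj).le
    rw [← mul_sub, abs_mul, abs_of_nonneg (Nat.cast_nonneg j)]
    calc (j:ℝ) * |α - p / q| ≤ q * (1 / (q * q)) := by gcongr
      _ = 1 / q := by field_simp
  obtain ⟨θ, hθ0, hθ1, hθ⟩ := fract_sum p q hq hpq (x - 1 / q)
  obtain ⟨φ, hφ0, hφ1, hφ⟩ := fract_sum p q hq hpq (x + 1 / q)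
  have up : ∑ j ∈ Finset.range q, Int.fract (x + j * α) ≤
      ∑ j ∈ Finset.range q, (Int.fract (x - 1 / q + j * (p / q)) + 2 / q) := by
    refine Finset.sum_le_sum fun j hj => ?_
    have h1 := abs_le.1 (hd j hj)
    have h2 : (⌊x - 1 / q + j * (p / q)⌋ : ℝ) ≤ ⌊x + j * α⌋ := by
      exact Int.cast_le.2 (Int.floor_le_floor (by linarith))
    have e : (2:ℝ) / q = 1 / q + 1 / q := by ring
    rw [Int.fract, Int.fract, e]; linarith
  have lo : ∑ j ∈ Finset.range q, (Int.fract (x + 1 / q + j * (p / q)) - 2 / q) ≤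
      ∑ j ∈ Finset.range q, Int.fract (x + j * α) := by
    refine Finset.sum_le_sum fun j hj => ?_
    have h1 := abs_le.1 (hd j hj)
    have h2 : (⌊x + j * α⌋ : ℝ) ≤ ⌊x + 1 / q + j * (p / q)⌋ := by
      exact Int.cast_le.2 (Int.floor_le_floor (by linarith))
    have e : (2:ℝ) / q = 1 / q + 1 / q := by ring
    rw [Int.fract, Int.fract, e]; linarith
  rw [Finset.sum_add_distrib, hθ] at up
  rw [Finset.sum_sub_distrib, hφ] at lo
  rw [Finset.sum_sub_distrib]
  simp only [Finset.sum_const, Finset.card_range, nsmul_eq_mul] at up lo ⊢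
  rw [mul_div_cancel₀ _ hqr.ne'] at up lo
  rw [abs_le]; constructor <;> linarith

theorem equi (α : ℝ) (hirr : Irrational α) (ε : ℝ) (hε : 0 < ε) :
    ∃ C : ℝ, 0 ≤ C ∧ ∀ n : ℕ,
      |∑ i ∈ Finset.range n, (Int.fract (α * ((i:ℝ) + 1)) - 1 / 2)| ≤ ε * n + C := by
  obtain ⟨K, hK⟩ := exists_nat_gt (4 / ε)
  obtain ⟨δ, hδ, hδ0⟩ := (((hirr.eventually_forall_le_dist_cast_rat_of_den_le K).filter_mono
    nhdsWithin_le_nhds).and (self_mem_nhdsWithin : Set.Ioi (0:ℝ) ∈ 𝓝[>] 0)).exists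
  have hδ0 : 0 < δ := hδ0
  obtain ⟨n, hn⟩ := exists_nat_gt (1 / δ)
  have hn0 : (0:ℝ) < n := lt_trans (by positivity) hn
  obtain ⟨r, hr, hrn⟩ := Real.exists_rat_abs_sub_le_and_den_le α (n := n) (by exact_mod_cast hn0)
  have hq : 0 < r.den := r.den_pos
  have hqr : (0:ℝ) < r.den := by exact_mod_cast hq
  have hq1 : (1:ℝ) ≤ r.den := by exact_mod_cast hq
  have hrn' : (r.den:ℝ) ≤ n := by exact_mod_cast hrn
  have hKq : K < r.den := by
    by_contra hcon
    have h1 := hδ r (not_lt.1 hcon)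
    rw [Real.dist_eq] at h1
    have h2 : 1 / (((n:ℝ) + 1) * r.den) < δ := by
      rw [div_lt_iff₀ (by positivity)]
      rw [div_lt_iff₀ hδ0] at hn
      nlinarith [mul_nonneg (mul_pos hn0 hδ0).le (sub_nonneg.2 hq1), mul_pos hδ0 hqr]
    linarith
  have hcop : IsCoprime r.num (r.den : ℤ) := by
    rw [Int.isCoprime_iff_gcd_eq_one]; exact r.reduced
  have happ : |α - r.num / r.den| ≤ 1 / (r.den * r.den) := by
    rw [← Rat.cast_def]
    refine hr.trans ?_
    gcongr
    linarith
  set q := r.den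
  have h4 : 4 ≤ ε * q := by
    have : (K:ℝ) < q := by exact_mod_cast hKq
    rw [div_lt_iff₀ hε] at hK
    nlinarith
  refine ⟨q, hqr.le, fun N => ?_⟩
  induction N using Nat.strong_induction_on with
  | _ N ih =>
    by_cases hN : N < q
    · have h1 : |∑ i ∈ Finset.range N, (Int.fract (α * ((i:ℝ) + 1)) - 1 / 2)| ≤
        ∑ i ∈ Finset.range N, (1:ℝ) := by
        refine (Finset.abs_sum_le_sum_abs _ _).trans (Finset.sum_le_sum fun i _ => ?_)
        have f0 := Int.fract_nonneg (α * ((i:ℝ) + 1))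
        have f1 := Int.fract_lt_one (α * ((i:ℝ) + 1))
        rw [abs_le]; constructor <;> linarith
      simp only [Finset.sum_const, Finset.card_range, nsmul_eq_mul, mul_one] at h1
      have : (N:ℝ) ≤ q := by exact_mod_cast hN.le
      have : 0 ≤ ε * N := by positivity
      linarith
    · obtain ⟨M, rfl⟩ := Nat.exists_eq_add_of_le (not_lt.1 hN)
      rw [add_comm q M, Finset.sum_range_add]
      have h1 := ih M (by omega)
      have h2 := block α r.num q hq hcop happ (α * (M + 1))
      have h3 : ∑ j ∈ Finset.range q, (Int.fract (α * (M + 1) + j * α) - 1 / 2) =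
        ∑ j ∈ Finset.range q, (Int.fract (α * (((M + j : ℕ) : ℝ) + 1)) - 1 / 2) := by
        refine Finset.sum_congr rfl fun j _ => ?_
        push_cast; ring_nf
      rw [h3] at h2
      refine (abs_add_le _ _).trans ?_
      rw [Nat.cast_add, mul_add]
      linarith

theorem tsum_bd (f : ℕ → ℝ) (K : ℝ) (h : ∀ N, |∑ i ∈ Finset.range N, f i| ≤ K) :
    |∑' i, f i| ≤ K := by
  by_cases hf : Summable f
  · exact le_of_tendsto hf.hasSum.tendsto_sum_nat.abs (Eventually.of_forall h)
  · rw [tsum_eq_zero_of_not_summable hf]; simpa using h 0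

theorem exp_lower (x : ℝ) (hx : 0 ≤ x) : x * rexp (x / 2) ≤ rexp x - 1 := by
  have h := Real.self_le_sinh_iff.2 (by positivity : 0 ≤ x / 2)
  rw [Real.sinh_eq] at h
  have e1 : rexp x = rexp (x/2) * rexp (x/2) := by rw [← Real.exp_add]; ring_nf
  have e2 : rexp (x/2) * rexp (-(x/2)) = 1 := by rw [← Real.exp_add]; simp
  nlinarith [Real.exp_pos (x/2)]

theorem sum1 (α t : ℝ) (hα : 1 < α) (ht : 0 < t) (ht1 : t ≤ rexp (-1)) (N : ℕ) :
    ∑ i ∈ Finset.range N, t / (rexp (t * (α * ((i:ℝ) + 1))) - 1) ≤ 3 * |Real.log t| := by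
  have hα0 : 0 < α := by linarith
  set s := t * α / 2 with hs
  have hs0 : 0 < s := by positivity
  have hq1 : rexp (-s) < 1 := by rw [Real.exp_lt_one_iff]; linarith
  have hsum := Real.hasSum_pow_div_log_of_abs_lt_one (x := rexp (-s))
    (by rw [abs_of_pos (Real.exp_pos _)]; exact hq1)
  have h1 : ∑ i ∈ Finset.range N, t / (rexp (t * (α * ((i:ℝ) + 1))) - 1) ≤
      ∑ i ∈ Finset.range N, rexp (-s) ^ (i + 1) / ((i:ℝ) + 1) := by
    refine Finset.sum_le_sum fun i _ => ?_
    have hx : 0 < t * (α * ((i:ℝ) + 1)) := by positivity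
    have h2 := exp_lower _ hx.le
    have e : rexp (-s) ^ (i + 1) = (rexp (t * (α * ((i:ℝ) + 1)) / 2))⁻¹ := by
      rw [← Real.exp_nat_mul, ← Real.exp_neg]; congr 1; push_cast; rw [hs]; ring
    rw [e]
    set E := rexp (t * (α * ((i:ℝ) + 1)) / 2) with hE
    have hE0 : 0 < E := Real.exp_pos _
    have hpos : 0 < t * (α * ((i:ℝ) + 1)) * E := by positivity
    calc _ ≤ t / (t * (α * ((i:ℝ) + 1)) * E) := by gcongr
      _ = E⁻¹ / ((i:ℝ) + 1) / α := by field_simp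
      _ ≤ _ := div_le_self (by positivity) hα.le
  have h2 := hsum.summable.sum_le_tsum (Finset.range N) (fun i _ => by positivity)
  rw [hsum.tsum_eq] at h2
  refine h1.trans (h2.trans ?_)
  have hlt : Real.log t ≤ -1 := by
    have := Real.log_le_log ht ht1; rwa [Real.log_exp] at this
  rw [abs_of_neg (by linarith)]
  have ht1' : t ≤ 1 := ht1.trans (by rw [Real.exp_le_one_iff]; norm_num)
  have h3 : t / 3 ≤ 1 - rexp (-s) := by
    have h5 : rexp (-s) ≤ 1 / (1 + t / 2) := by
      rw [Real.exp_neg, ← one_div]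
      have := Real.add_one_le_exp s
      have : t / 2 ≤ s := by rw [hs]; nlinarith
      gcongr; linarith
    have h6 : 1 / (1 + t / 2) ≤ 1 - t / 3 := by
      rw [div_le_iff₀ (by positivity)]; nlinarith
    linarith
  have h4 := Real.log_le_log (by positivity) h3
  rw [Real.log_div ht.ne' (by norm_num)] at h4
  have h5 := Real.log_le_sub_one_of_pos (show (0:ℝ) < 3 by norm_num)
  linarith

theorem sum2 (α t : ℝ) (hα : 1 < α) (ht : 0 < t) (N : ℕ) :
    ∑ i ∈ Finset.range N, t / (rexp (t * (α * ((i:ℝ) + 1))) + 1) ≤ 1 := by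
  have hα0 : 0 < α := by linarith
  set u := t * α with hu
  have hu0 : 0 < u := by positivity
  have h1 : ∀ N : ℕ, ∑ i ∈ Finset.range N, t / (rexp (t * (α * ((i:ℝ) + 1))) + 1) ≤
      1 - rexp (-(u * N)) := by
    intro N
    induction N with
    | zero => simp
    | succ n ih =>
      rw [Finset.sum_range_succ]
      have e1 : rexp (-(u * ((n+1:ℕ):ℝ))) = (rexp (t * (α * ((n:ℝ) + 1))))⁻¹ := by
        rw [← Real.exp_neg]; congr 1; push_cast; rw [hu]; ring
      have e2 : rexp (-(u * n)) = (rexp (t * (α * ((n:ℝ) + 1))))⁻¹ * rexp u := by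
        rw [← Real.exp_neg, ← Real.exp_add]; congr 1; rw [hu]; ring
      rw [e1]; rw [e2] at ih
      set E := rexp (t * (α * ((n:ℝ) + 1)))
      have hE : 0 < E := Real.exp_pos _
      have h3 : t / (E + 1) ≤ t / E := by gcongr; linarith
      have h4 : t + 1 ≤ rexp u := by
        have := Real.add_one_le_exp u
        have : t ≤ u := by rw [hu]; nlinarith
        linarith
      have h5 : E⁻¹ * (t + 1) ≤ E⁻¹ * rexp u := by gcongr
      have h6 : t / E = E⁻¹ * t := by ring
      linarith
  have := h1 N
  linarith [Real.exp_pos (-(u * N))]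

theorem summ (α t : ℝ) (hα : 1 < α) (ht : 0 < t) :
    Summable fun i : ℕ => t * (Int.fract (α * ((i:ℝ) + 1)) - 1 / 2) /
      (rexp (t * (α * ((i:ℝ) + 1))) - 1) := by
  have hα0 : 0 < α := by linarith
  have hu0 : 0 < t * α := by positivity
  have hg : Summable fun i : ℕ => (1 / α) * rexp (-(t * α / 2)) ^ i :=
    (summable_geometric_of_lt_one (Real.exp_pos _).le
      (by rw [Real.exp_lt_one_iff]; linarith)).mul_left _
  refine Summable.of_norm_bounded hg fun i => ?_
  have hx : 0 < t * (α * ((i:ℝ) + 1)) := by positivity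
  have h2 := exp_lower _ hx.le
  have f0 := Int.fract_nonneg (α * ((i:ℝ) + 1))
  have f1 := Int.fract_lt_one (α * ((i:ℝ) + 1))
  have hb : |Int.fract (α * ((i:ℝ) + 1)) - 1 / 2| ≤ 1 := by
    rw [abs_le]; constructor <;> linarith
  have hp : t * α * rexp (t * α / 2 * i) ≤ t * (α * ((i:ℝ) + 1)) * rexp (t * (α * ((i:ℝ) + 1)) / 2) := by
    have : t * α / 2 * i ≤ t * (α * ((i:ℝ) + 1)) / 2 := by nlinarith
    have h0 : t * α ≤ t * (α * ((i:ℝ) + 1)) := by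
      have : (0:ℝ) ≤ i := Nat.cast_nonneg i
      nlinarith [mul_nonneg hu0.le this]
    gcongr
  have hpos : 0 < t * α * rexp (t * α / 2 * i) := by positivity
  rw [Real.norm_eq_abs, abs_div, abs_mul, abs_of_pos ht, abs_of_pos (by linarith : 0 < rexp (t * (α * ((i:ℝ) + 1))) - 1)]
  calc _ ≤ t * 1 / (t * α * rexp (t * α / 2 * i)) := by gcongr; linarith
    _ = 1 / α * (rexp (t * α / 2 * i))⁻¹ := by field_simp
    _ = _ := by rw [← Real.exp_neg, ← Real.exp_nat_mul]; congr 2; ring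

theorem RBound1 (α : ℝ) (hα : 1 < α) (ε C : ℝ) (hε : 0 < ε) (hC : 0 ≤ C)
    (hS : ∀ n : ℕ, |∑ i ∈ Finset.range n, (Int.fract (α * ((i:ℝ) + 1)) - 1 / 2)| ≤ ε * n + C)
    (t : ℝ) (ht : 0 < t) (ht1 : t ≤ rexp (-1)) :
    |∑' i : ℕ, t * (Int.fract (α * ((i:ℝ) + 1)) - 1 / 2) /
      (rexp (t * (α * ((i:ℝ) + 1))) - 1)| ≤ ε * (3 * |Real.log t|) + C := by
  have hα0 : 0 < α := by linarith
  refine tsum_bd _ _ fun N => ?_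
  have hpos : ∀ i : ℕ, 0 < rexp (t * (α * ((i:ℝ) + 1))) - 1 := by
    intro i
    have : 0 < t * (α * ((i:ℝ) + 1)) := by positivity
    have := Real.one_lt_exp_iff.2 this
    linarith
  have h := abel _ (fun i : ℕ => t / (rexp (t * (α * ((i:ℝ) + 1))) - 1)) ε C hS
    (by intro i j hij
        have := hpos i
        have : (i:ℝ) ≤ j := by exact_mod_cast hij
        simp only []
        gcongr) (fun i => div_nonneg ht.le (hpos i).le) N
  have e : ∀ i : ℕ, t * (Int.fract (α * ((i:ℝ) + 1)) - 1 / 2) / (rexp (t * (α * ((i:ℝ) + 1))) - 1)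
     = (Int.fract (α * ((i:ℝ) + 1)) - 1 / 2) * (t / (rexp (t * (α * ((i:ℝ) + 1))) - 1)) := by
    intro i; ring
  rw [Finset.sum_congr rfl (fun i _ => e i)]
  refine h.trans ?_
  have h0 : t / (rexp (t * (α * (((0:ℕ):ℝ) + 1))) - 1) ≤ 1 := by
    rw [div_le_one (hpos 0)]
    have := Real.add_one_le_exp (t * (α * (((0:ℕ):ℝ) + 1)))
    have e0 : t * (α * (((0:ℕ):ℝ) + 1)) = t * α := by simp
    rw [e0] at this ⊢
    nlinarith
  have := mul_le_mul_of_nonneg_left (sum1 α t hα ht ht1 N) hε.le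
  have := mul_le_mul_of_nonneg_left h0 hC
  linarith

theorem RBound2 (α : ℝ) (hα : 1 < α) (ε C : ℝ) (hε : 0 < ε) (hC : 0 ≤ C)
    (hS : ∀ n : ℕ, |∑ i ∈ Finset.range n, (Int.fract (α * ((i:ℝ) + 1)) - 1 / 2)| ≤ ε * n + C)
    (t : ℝ) (ht : 0 < t) :
    |∑' i : ℕ, (Int.fract (α * ((i:ℝ) + 1)) - 1 / 2) *
      (t / (rexp (t * (α * ((i:ℝ) + 1))) + 1))| ≤ ε + C * t := by
  have hα0 : 0 < α := by linarith
  refine tsum_bd _ _ fun N => ?_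
  have h := abel _ (fun i : ℕ => t / (rexp (t * (α * ((i:ℝ) + 1))) + 1)) ε C hS
    (by intro i j hij
        have : (i:ℝ) ≤ j := by exact_mod_cast hij
        simp only []
        gcongr) (fun i => by positivity) N
  refine h.trans ?_
  have h0 : t / (rexp (t * (α * (((0:ℕ):ℝ) + 1))) + 1) ≤ t :=
    div_le_self ht.le (by linarith [Real.exp_pos (t * (α * (((0:ℕ):ℝ) + 1)))])
  have := mul_le_mul_of_nonneg_left (sum2 α t hα ht N) hε.le
  have := mul_le_mul_of_nonneg_left h0 hC
  linarith


theorem stmt18 (α : ℝ) (hα : 1 < α) (hirr : Irrational α) :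
    ((fun t : ℝ => RBeatty α t) =o[𝓝[>] (0 : ℝ)] (fun t => |Real.log t|)) ∧
    Tendsto (fun t : ℝ => RBeatty α t - RBeatty α (2 * t)) (𝓝[>] (0 : ℝ)) (𝓝 0) := by
  have hα0 : 0 < α := by linarith
  constructor
  · rw [isLittleO_iff]
    intro c hc
    obtain ⟨C, hC, hS⟩ := equi α hirr (c / 6) (by positivity)
    have hlog : ∀ᶠ t : ℝ in 𝓝[>] 0, Real.log t ≤ -(2 * C / c) :=
      Real.tendsto_log_nhdsGT_zero.eventually (eventually_le_atBot _)
    filter_upwards [hlog, Ioc_mem_nhdsGT (Real.exp_pos (-1))] with t h1 h2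
    have h3 := RBound1 α hα (c / 6) C (by positivity) hC hS t h2.1 h2.2
    rw [Real.norm_eq_abs, Real.norm_eq_abs, abs_abs]
    refine h3.trans ?_
    have h4 : 2 * C / c ≤ |Real.log t| := le_trans (by linarith) (neg_le_abs _)
    rw [div_le_iff₀ hc] at h4
    linarith
  · rw [Metric.tendsto_nhds]
    intro c hc
    obtain ⟨C, hC, hS⟩ := equi α hirr (c / 2) (by positivity)
    have hp : 0 < c / (2 * (C + 1)) := by positivity
    filter_upwards [Ioo_mem_nhdsGT hp] with t ht
    have ht0 : 0 < t := ht.1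
    have h2 := RBound2 α hα (c / 2) C (by positivity) hC hS t ht0
    have e : RBeatty α t - RBeatty α (2 * t) = ∑' i : ℕ, (Int.fract (α * ((i:ℝ) + 1)) - 1 / 2) *
      (t / (rexp (t * (α * ((i:ℝ) + 1))) + 1)) := by
      unfold RBeatty
      rw [← (summ α t hα ht0).tsum_sub (summ α (2 * t) hα (by positivity))]
      congr 1
      ext i
      have hx : 0 < t * (α * ((i:ℝ) + 1)) := by positivity
      have hx1 := Real.one_lt_exp_iff.2 hx
      have e2 : rexp (2 * t * (α * ((i:ℝ) + 1))) = rexp (t * (α * ((i:ℝ) + 1))) ^ 2 := by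
        rw [← Real.exp_nat_mul]; congr 1; push_cast; ring
      rw [e2]
      set E := rexp (t * (α * ((i:ℝ) + 1)))
      have n1 : E - 1 ≠ 0 := by linarith
      have n2 : E + 1 ≠ 0 := by linarith
      have e3 : E ^ 2 - 1 = (E - 1) * (E + 1) := by ring
      rw [e3]
      field_simp
      ring
    rw [e, Real.dist_eq, sub_zero]
    refine h2.trans_lt ?_
    have h5 := ht.2
    rw [lt_div_iff₀ (by positivity)] at h5
    nlinarith
end
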